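/- arXiv:1812.03439 — 2 statements merged into one kernel-verified Lean document; each statement's English description precedes it below -/
import Mathlib

section
/- Let H be a quasi-Hopf algebra over a field k with bijective antipode S (inverse S̄), Drinfeld twist f = f1⊗f2 with inverse f̄1⊗f̄2, and set U^L = f̄1S(q^R_2) ⊗ f̄2S(q^R_1) and V^L = S̄(f2 p^R_2) ⊗ S̄(f1 p^R_1). Then the following two equations hold in H⊗H: (q^L_2 ⊗ 1)·V^L·Δ(S̄(q^L_1)) = q^R and Δ(S(p^L_1))·U^L·(p^L_2 ⊗ 1) = p^R. -/
open scoped TensorProduct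

noncomputable section

/-- A quasi-Hopf algebra over a field `k`, presented together with explicit
(Sweedler-style) finite representations of the comultiplication and of the
associator `φ` and its inverse `φ⁻¹`.  The fields `n, d1, d2` give, for every
`h : H`, a finite family with `Δ h = ∑ i < n h, d1 h i ⊗ d2 h i`; similarly
`P1, P2, P3` (resp. `Q1, Q2, Q3`) are the components of `φ` (resp. `φ⁻¹`). -/
structure QuasiHopf (k H : Type) [Field k] [Ring H] [Algebra k H] where
  comul : H →ₐ[k] H ⊗[k] H
  counit : H →ₐ[k] k
  n : H → ℕ
  d1 : H → ℕ → H
  d2 : H → ℕ → H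
  comul_eq : ∀ h, comul h = ∑ i ∈ Finset.range (n h), d1 h i ⊗ₜ[k] d2 h i
  np : ℕ
  P1 : ℕ → H
  P2 : ℕ → H
  P3 : ℕ → H
  nq : ℕ
  Q1 : ℕ → H
  Q2 : ℕ → H
  Q3 : ℕ → H
  S : H →ₗ[k] H
  Sinv : H →ₗ[k] H
  alpha : H
  beta : H
  S_one : S 1 = 1
  S_mul : ∀ x y : H, S (x * y) = S y * S x
  Sinv_S : ∀ x : H, Sinv (S x) = x
  S_Sinv : ∀ x : H, S (Sinv x) = x
  phi_phiInv :
    (∑ a ∈ Finset.range np, P1 a ⊗ₜ[k] (P2 a ⊗ₜ[k] P3 a)) *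
      (∑ b ∈ Finset.range nq, Q1 b ⊗ₜ[k] (Q2 b ⊗ₜ[k] Q3 b)) = 1
  phiInv_phi :
    (∑ b ∈ Finset.range nq, Q1 b ⊗ₜ[k] (Q2 b ⊗ₜ[k] Q3 b)) *
      (∑ a ∈ Finset.range np, P1 a ⊗ₜ[k] (P2 a ⊗ₜ[k] P3 a)) = 1
  qcoassoc : ∀ h : H,
    ∑ i ∈ Finset.range (n h), d1 h i ⊗ₜ[k] comul (d2 h i) =
      (∑ a ∈ Finset.range np, P1 a ⊗ₜ[k] (P2 a ⊗ₜ[k] P3 a)) *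
        (∑ i ∈ Finset.range (n h), ∑ j ∈ Finset.range (n (d1 h i)),
          d1 (d1 h i) j ⊗ₜ[k] (d2 (d1 h i) j ⊗ₜ[k] d2 h i)) *
        (∑ b ∈ Finset.range nq, Q1 b ⊗ₜ[k] (Q2 b ⊗ₜ[k] Q3 b))
  counit_left : ∀ h : H, ∑ i ∈ Finset.range (n h), counit (d1 h i) • d2 h i = h
  counit_right : ∀ h : H, ∑ i ∈ Finset.range (n h), counit (d2 h i) • d1 h i = h
  pentagon :
    (∑ a ∈ Finset.range np, P1 a ⊗ₜ[k] (P2 a ⊗ₜ[k] comul (P3 a))) *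
      (∑ a ∈ Finset.range np, ∑ i ∈ Finset.range (n (P1 a)),
        d1 (P1 a) i ⊗ₜ[k] (d2 (P1 a) i ⊗ₜ[k] (P2 a ⊗ₜ[k] P3 a))) =
    ((1 : H) ⊗ₜ[k] (∑ a ∈ Finset.range np, P1 a ⊗ₜ[k] (P2 a ⊗ₜ[k] P3 a))) *
      (∑ a ∈ Finset.range np, ∑ i ∈ Finset.range (n (P2 a)),
        P1 a ⊗ₜ[k] (d1 (P2 a) i ⊗ₜ[k] (d2 (P2 a) i ⊗ₜ[k] P3 a))) *
      (∑ a ∈ Finset.range np, P1 a ⊗ₜ[k] (P2 a ⊗ₜ[k] (P3 a ⊗ₜ[k] (1 : H))))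
  counit_mid_phi :
    ∑ a ∈ Finset.range np, counit (P2 a) • (P1 a ⊗ₜ[k] P3 a) = (1 : H) ⊗ₜ[k] (1 : H)
  antipode_alpha : ∀ h : H,
    ∑ i ∈ Finset.range (n h), S (d1 h i) * alpha * d2 h i = counit h • alpha
  antipode_beta : ∀ h : H,
    ∑ i ∈ Finset.range (n h), d1 h i * beta * S (d2 h i) = counit h • beta
  nondeg_1 : ∑ a ∈ Finset.range np, P1 a * beta * S (P2 a) * alpha * P3 a = 1
  nondeg_2 : ∑ b ∈ Finset.range nq, S (Q1 b) * alpha * Q2 b * beta * S (Q3 b) = 1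
  counit_alpha : counit alpha = 1
  counit_beta : counit beta = 1

namespace QuasiHopf

variable {k H : Type} [Field k] [Ring H] [Algebra k H] (q : QuasiHopf k H)

/-- The associator `φ` as an element of `H ⊗ H ⊗ H`. -/
def Phi : H ⊗[k] (H ⊗[k] H) :=
  ∑ a ∈ Finset.range q.np, q.P1 a ⊗ₜ[k] (q.P2 a ⊗ₜ[k] q.P3 a)

/-- `φ⁻¹` as an element of `H ⊗ H ⊗ H`. -/
def PhiInv : H ⊗[k] (H ⊗[k] H) :=
  ∑ b ∈ Finset.range q.nq, q.Q1 b ⊗ₜ[k] (q.Q2 b ⊗ₜ[k] q.Q3 b)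

/-- first components of `p^R = φ̄1 ⊗ φ̄2 β S(φ̄3)` -/
def pR1 (b : ℕ) : H := q.Q1 b

def pR2 (b : ℕ) : H := q.Q2 b * q.beta * q.S (q.Q3 b)

def pRE : H ⊗[k] H := ∑ b ∈ Finset.range q.nq, q.pR1 b ⊗ₜ[k] q.pR2 b

/-- components of `q^R = φ1 ⊗ S̄(α φ3) φ2` -/
def qR1 (a : ℕ) : H := q.P1 a

def qR2 (a : ℕ) : H := q.Sinv (q.alpha * q.P3 a) * q.P2 a

def qRE : H ⊗[k] H := ∑ a ∈ Finset.range q.np, q.qR1 a ⊗ₜ[k] q.qR2 a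

/-- components of `p^L = φ2 S̄(φ1 β) ⊗ φ3` -/
def pL1 (a : ℕ) : H := q.P2 a * q.Sinv (q.P1 a * q.beta)

def pL2 (a : ℕ) : H := q.P3 a

def pLE : H ⊗[k] H := ∑ a ∈ Finset.range q.np, q.pL1 a ⊗ₜ[k] q.pL2 a

/-- components of `q^L = S(φ̄1) α φ̄2 ⊗ φ̄3` -/
def qL1 (b : ℕ) : H := q.S (q.Q1 b) * q.alpha * q.Q2 b

def qL2 (b : ℕ) : H := q.Q3 b

def qLE : H ⊗[k] H := ∑ b ∈ Finset.range q.nq, q.qL1 b ⊗ₜ[k] q.qL2 b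

/-- `𝕒 = S(φ̄1 φ2) α φ̄2 φ3₍₁₎ ⊗ S(φ1) α φ̄3 φ3₍₂₎` -/
def aEl : H ⊗[k] H :=
  ∑ a ∈ Finset.range q.np, ∑ b ∈ Finset.range q.nq, ∑ m ∈ Finset.range (q.n (q.P3 a)),
    (q.S (q.Q1 b * q.P2 a) * q.alpha * q.Q2 b * q.d1 (q.P3 a) m) ⊗ₜ[k]
      (q.S (q.P1 a) * q.alpha * q.Q3 b * q.d2 (q.P3 a) m)

/-- `𝕓 = φ1₍₁₎ φ̄1 β S(φ3) ⊗ φ1₍₂₎ φ̄2 β S(φ2 φ̄3)` -/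
def bEl : H ⊗[k] H :=
  ∑ a ∈ Finset.range q.np, ∑ b ∈ Finset.range q.nq, ∑ m ∈ Finset.range (q.n (q.P1 a)),
    (q.d1 (q.P1 a) m * q.Q1 b * q.beta * q.S (q.P3 a)) ⊗ₜ[k]
      (q.d2 (q.P1 a) m * q.Q2 b * q.beta * q.S (q.P2 a * q.Q3 b))

/-- `(S ⊗ S)(Δ^cop x) = S(x₍₂₎) ⊗ S(x₍₁₎)` -/
def scop (x : H) : H ⊗[k] H :=
  ∑ m ∈ Finset.range (q.n x), q.S (q.d2 x m) ⊗ₜ[k] q.S (q.d1 x m)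

/-- The Drinfeld twist `f = (S⊗S)(Δ^cop(p^R_1)) · 𝕒 · Δ(p^R_2)`. -/
def twist : H ⊗[k] H :=
  ∑ b ∈ Finset.range q.nq, q.scop (q.pR1 b) * q.aEl * q.comul (q.pR2 b)

/-- `f⁻¹ = Δ(q^L_1) · 𝕓 · (S⊗S)(Δ^cop(q^L_2))`. -/
def twistInv : H ⊗[k] H :=
  ∑ b ∈ Finset.range q.nq, q.comul (q.qL1 b) * q.bEl * q.scop (q.qL2 b)

/-- `x ⊗ y ↦ S y ⊗ S x` -/
def sswap : H ⊗[k] H →ₗ[k] H ⊗[k] H :=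
  (TensorProduct.map q.S q.S).comp (TensorProduct.comm k H H).toLinearMap

/-- `x ⊗ y ↦ S̄ y ⊗ S̄ x` -/
def sswapInv : H ⊗[k] H →ₗ[k] H ⊗[k] H :=
  (TensorProduct.map q.Sinv q.Sinv).comp (TensorProduct.comm k H H).toLinearMap

/-- `U^L = f̄1 S(q^R_2) ⊗ f̄2 S(q^R_1)` -/
def UL : H ⊗[k] H := q.twistInv * q.sswap q.qRE

/-- `V^L = S̄(f2 p^R_2) ⊗ S̄(f1 p^R_1)` -/
def VL : H ⊗[k] H := q.sswapInv (q.twist * q.pRE)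

/-- `U^R = S̄(q^L_2 f̄2) ⊗ S̄(q^L_1 f̄1)` -/
def UR : H ⊗[k] H := q.sswapInv (q.qLE * q.twistInv)

/-- `V^R = S(p^L_2) f1 ⊗ S(p^L_1) f2` -/
def VR : H ⊗[k] H := q.sswap q.pLE * q.twist

/-- `h ↦ h ↼ μ = μ(h₍₁₎) h₍₂₎` -/
def lhook (mu : H →ₐ[k] k) : H →ₗ[k] H :=
  (TensorProduct.lid k H).toLinearMap.comp
    ((TensorProduct.map mu.toLinearMap LinearMap.id).comp q.comul.toLinearMap)

/-- `h ↦ μ ⇀ h = μ(h₍₂₎) h₍₁₎` -/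
def rhook (mu : H →ₐ[k] k) : H →ₗ[k] H :=
  (TensorProduct.rid k H).toLinearMap.comp
    ((TensorProduct.map LinearMap.id mu.toLinearMap).comp q.comul.toLinearMap)

/-- `W^L = μ(φ̄1) f̄1 S(q^R_2 φ̄3) ⊗ f̄2 S((q^R_1 ↼ μ) φ̄2)` -/
def WL (mu : H →ₐ[k] k) : H ⊗[k] H :=
  q.twistInv * q.sswap ((TensorProduct.map (q.lhook mu) LinearMap.id q.qRE) *
    (∑ b ∈ Finset.range q.nq, mu (q.Q1 b) • (q.Q2 b ⊗ₜ[k] q.Q3 b)))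

/-- `W^R = μ(φ3) S̄((μ ⇀ q^L_2) φ2 f̄2) ⊗ S̄(q^L_1 φ1 f̄1)` -/
def WR (mu : H →ₐ[k] k) : H ⊗[k] H :=
  q.sswapInv ((TensorProduct.map LinearMap.id (q.rhook mu) q.qLE) *
    (∑ a ∈ Finset.range q.np, mu (q.P3 a) • (q.P1 a ⊗ₜ[k] q.P2 a)) * q.twistInv)

section Modules

variable {V W X : Type} [AddCommGroup V] [Module k V] [AddCommGroup W] [Module k W]
  [AddCommGroup X] [Module k X]

/-- The tensor-product action `h · (v ⊗ w) = h₍₁₎ v ⊗ h₍₂₎ w`. -/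
def tensAct (ρV : H → Module.End k V) (ρW : H → Module.End k W) (h : H) :
    Module.End k (V ⊗[k] W) :=
  ∑ i ∈ Finset.range (q.n h), TensorProduct.map (ρV (q.d1 h i)) (ρW (q.d2 h i))

/-- The action on the left dual: `(h · ξ)(x) = ξ(S(h) x)`. -/
def dualAct (ρX : H → Module.End k X) (h : H) : Module.End k (Module.Dual k X) :=
  LinearMap.dualMap (ρX (q.S h))

end Modules

end QuasiHopf

/-- `f` intertwines the two given `H`-actions. -/
def IsHLin {k H V W : Type} [Field k] [Ring H] [Algebra k H]
    [AddCommGroup V] [Module k V] [AddCommGroup W] [Module k W]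
    (ρV : H → Module.End k V) (ρW : H → Module.End k W) (f : V →ₗ[k] W) : Prop :=
  ∀ (h : H) (v : V), f (ρV h v) = ρW h (f v)

/-- `x ⊗ y ↦ λ(y) • x` -/
def hitR {k H : Type} [Field k] [Ring H] [Algebra k H] (lam : H →ₗ[k] k) :
    H ⊗[k] H →ₗ[k] H :=
  (TensorProduct.rid k H).toLinearMap.comp (TensorProduct.map LinearMap.id lam)

/-- `x ⊗ y ↦ λ(x) • y` -/
def hitL {k H : Type} [Field k] [Ring H] [Algebra k H] (lam : H →ₗ[k] k) :
    H ⊗[k] H →ₗ[k] H :=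
  (TensorProduct.lid k H).toLinearMap.comp (TensorProduct.map lam LinearMap.id)

namespace QuasiHopf

open TensorProduct

section Contraction

variable {k H A : Type} [Field k] [Ring H] [Algebra k H] [Semiring A] [Algebra k A]

theorem induction_two {p : H ⊗[k] H → Prop} (add : ∀ x y, p x → p y → p (x + y))
    (tmul : ∀ a b, p (a ⊗ₜ b)) (x : H ⊗[k] H) : p x :=
  TensorProduct.induction_on x (by simpa using tmul 0 0) tmul add

theorem induction_three {p : H ⊗[k] (H ⊗[k] H) → Prop} (add : ∀ x y, p x → p y → p (x + y))
    (tmul : ∀ a b c, p (a ⊗ₜ (b ⊗ₜ c))) (x : H ⊗[k] (H ⊗[k] H)) : p x :=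
  TensorProduct.induction_on x (by simpa using tmul 0 0 0)
    (fun a y => induction_two (p := fun y => p (a ⊗ₜ y))
      (fun x y hx hy => by rw [tmul_add]; exact add _ _ hx hy) (tmul a) y) add

theorem induction_four {p : H ⊗[k] (H ⊗[k] (H ⊗[k] H)) → Prop}
    (add : ∀ x y, p x → p y → p (x + y))
    (tmul : ∀ a b c d, p (a ⊗ₜ (b ⊗ₜ (c ⊗ₜ d)))) (x : H ⊗[k] (H ⊗[k] (H ⊗[k] H))) : p x :=
  TensorProduct.induction_on x (by simpa using tmul 0 0 0 0)
    (fun a y => induction_three (p := fun y => p (a ⊗ₜ y))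
      (fun x y hx hy => by rw [tmul_add]; exact add _ _ hx hy) (tmul a) y) add

/-- The instance of `mul_assoc` for four tensor factors, in a form `rw` and `simp` can use. -/
theorem mul_assoc_four (x y z : H ⊗[k] (H ⊗[k] (H ⊗[k] H))) : x * y * z = x * (y * z) :=
  mul_assoc x y z

theorem one_mul_four (x : H ⊗[k] (H ⊗[k] (H ⊗[k] H))) : 1 * x = x := one_mul x

theorem mul_one_four (x : H ⊗[k] (H ⊗[k] (H ⊗[k] H))) : x * 1 = x := mul_one x

theorem add_mul_four (x y z : H ⊗[k] (H ⊗[k] (H ⊗[k] H))) : (x + y) * z = x * z + y * z :=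
  NonUnitalNonAssocSemiring.right_distrib x y z

theorem mul_add_four (x y z : H ⊗[k] (H ⊗[k] (H ⊗[k] H))) : x * (y + z) = x * y + x * z :=
  NonUnitalNonAssocSemiring.left_distrib x y z

theorem smul_mul_four (r : k) (x y : H ⊗[k] (H ⊗[k] (H ⊗[k] H))) : (r • x) * y = r • (x * y) :=
  smul_mul_assoc r x y

theorem mul_smul_four (r : k) (x y : H ⊗[k] (H ⊗[k] (H ⊗[k] H))) : x * (r • y) = r • (x * y) :=
  mul_smul_comm r x y

/-- `x ⊗ y ↦ u x * v y` -/
def conv {V W : Type} [AddCommGroup V] [Module k V] [AddCommGroup W] [Module k W]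
    (u : V →ₗ[k] A) (v : W →ₗ[k] A) : V ⊗[k] W →ₗ[k] A :=
  LinearMap.mul' k A ∘ₗ TensorProduct.map u v

@[simp]
theorem conv_tmul {V W : Type} [AddCommGroup V] [Module k V] [AddCommGroup W] [Module k W]
    (u : V →ₗ[k] A) (v : W →ₗ[k] A) (x : V) (y : W) : conv u v (x ⊗ₜ[k] y) = u x * v y := rfl

/-- `a ↦ a ⊗ 1` -/
def inl : H →ₐ[k] H ⊗[k] H := Algebra.TensorProduct.includeLeft

/-- `a ↦ 1 ⊗ a` -/
def inr : H →ₐ[k] H ⊗[k] H := Algebra.TensorProduct.includeRight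

theorem inl_apply (a : H) : (inl a : H ⊗[k] H) = a ⊗ₜ 1 := rfl

theorem inr_apply (a : H) : (inr a : H ⊗[k] H) = 1 ⊗ₜ a := rfl

theorem inl_mul_inr (a b : H) : (inl a : H ⊗[k] H) * inr b = a ⊗ₜ b := by
  simp [inl_apply, inr_apply]

theorem inr_mul_inl (a b : H) : (inr b : H ⊗[k] H) * inl a = inl a * inr b := by
  simp [inl_apply, inr_apply]

theorem inr_mul_inl_assoc (a b : H) (x : H ⊗[k] H) :
    (inr b : H ⊗[k] H) * (inl a * x) = inl a * (inr b * x) := by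
  rw [← mul_assoc, inr_mul_inl, mul_assoc]

end Contraction

variable {k H A : Type} [Field k] [Ring H] [Algebra k H] [Semiring A] [Algebra k A]
  (q : QuasiHopf k H)

/-! ### Coproducts applied to tensor factors -/

/-- `Δ ⊗ id` on `H ⊗ M` -/
def comulFst (M : Type) [Semiring M] [Algebra k M] : H ⊗[k] M →ₐ[k] H ⊗[k] (H ⊗[k] M) :=
  (Algebra.TensorProduct.assoc k k k H H M).toAlgHom.comp
    (Algebra.TensorProduct.map q.comul (AlgHom.id k M))

/-- `id ⊗ Δ` on `H ⊗ H` -/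
def comulSnd : H ⊗[k] H →ₐ[k] H ⊗[k] (H ⊗[k] H) :=
  Algebra.TensorProduct.map (AlgHom.id k H) q.comul

/-- `Δ ⊗ id ⊗ id` -/
def comul₁ : H ⊗[k] (H ⊗[k] H) →ₐ[k] H ⊗[k] (H ⊗[k] (H ⊗[k] H)) := q.comulFst (H ⊗[k] H)

/-- `id ⊗ Δ ⊗ id` -/
def comul₂ : H ⊗[k] (H ⊗[k] H) →ₐ[k] H ⊗[k] (H ⊗[k] (H ⊗[k] H)) :=
  Algebra.TensorProduct.map (AlgHom.id k H) (q.comulFst H)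

/-- `id ⊗ id ⊗ Δ` -/
def comul₃ : H ⊗[k] (H ⊗[k] H) →ₐ[k] H ⊗[k] (H ⊗[k] (H ⊗[k] H)) :=
  Algebra.TensorProduct.map (AlgHom.id k H) q.comulSnd

/-- `x ↦ 1 ⊗ x` -/
def oneTmul : H ⊗[k] (H ⊗[k] H) →ₐ[k] H ⊗[k] (H ⊗[k] (H ⊗[k] H)) :=
  Algebra.TensorProduct.includeRight

/-- `x ↦ x ⊗ 1` -/
def tmulOne : H ⊗[k] (H ⊗[k] H) →ₐ[k] H ⊗[k] (H ⊗[k] (H ⊗[k] H)) :=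
  Algebra.TensorProduct.map (AlgHom.id k H) (Algebra.TensorProduct.map (AlgHom.id k H) inl)

theorem comulFst_tmul (M : Type) [Semiring M] [Algebra k M] (a : H) (b : M) :
    q.comulFst M (a ⊗ₜ b) = TensorProduct.assoc k H H M (q.comul a ⊗ₜ b) := rfl

theorem comulSnd_tmul (a b : H) : q.comulSnd (a ⊗ₜ b) = a ⊗ₜ q.comul b := rfl

theorem comul₁_tmul (a : H) (b : H ⊗[k] H) :
    q.comul₁ (a ⊗ₜ b) = TensorProduct.assoc k H H (H ⊗[k] H) (q.comul a ⊗ₜ b) := rfl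

theorem comul₂_tmul (a b c : H) :
    q.comul₂ (a ⊗ₜ (b ⊗ₜ c)) = a ⊗ₜ TensorProduct.assoc k H H H (q.comul b ⊗ₜ c) := rfl

theorem comul₃_tmul (a b c : H) :
    q.comul₃ (a ⊗ₜ (b ⊗ₜ c)) = a ⊗ₜ (b ⊗ₜ q.comul c) := rfl

theorem oneTmul_apply (x : H ⊗[k] (H ⊗[k] H)) :
    oneTmul x = (1 : H) ⊗ₜ[k] x := rfl

theorem tmulOne_tmul (a b c : H) :
    tmulOne (a ⊗ₜ[k] (b ⊗ₜ[k] c)) = a ⊗ₜ[k] (b ⊗ₜ[k] (c ⊗ₜ[k] (1 : H))) := rfl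

theorem phi_mul_phiInv : q.Phi * q.PhiInv = 1 := q.phi_phiInv

theorem phiInv_mul_phi : q.PhiInv * q.Phi = 1 := q.phiInv_phi

theorem phiInv_mul_comulSnd (h : H) :
    q.PhiInv * q.comulSnd (q.comul h) = q.comulFst H (q.comul h) * q.PhiInv := by
  have e : q.comulSnd (q.comul h) = q.Phi * q.comulFst H (q.comul h) * q.PhiInv := by
    have h₁ : q.comulSnd (q.comul h) =
        ∑ i ∈ Finset.range (q.n h), q.d1 h i ⊗ₜ[k] q.comul (q.d2 h i) := by
      simp [q.comul_eq h, comulSnd_tmul]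
    have h₂ : q.comulFst H (q.comul h) =
        ∑ i ∈ Finset.range (q.n h), ∑ j ∈ Finset.range (q.n (q.d1 h i)),
          q.d1 (q.d1 h i) j ⊗ₜ[k] (q.d2 (q.d1 h i) j ⊗ₜ[k] q.d2 h i) := by
      simp [q.comul_eq h, comulFst_tmul, q.comul_eq (q.d1 h _), sum_tmul]
    rw [h₁, h₂]
    exact q.qcoassoc h
  rw [e, mul_assoc, ← mul_assoc, phiInv_mul_phi, one_mul]

theorem comul₃_mul_comul₁_phi :
    q.comul₃ q.Phi * q.comul₁ q.Phi = oneTmul q.Phi * q.comul₂ q.Phi * tmulOne q.Phi := by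
  have h₁ : q.comul₁ q.Phi = ∑ a ∈ Finset.range q.np, ∑ i ∈ Finset.range (q.n (q.P1 a)),
      q.d1 (q.P1 a) i ⊗ₜ[k] (q.d2 (q.P1 a) i ⊗ₜ[k] (q.P2 a ⊗ₜ[k] q.P3 a)) := by
    simp [Phi, comul₁_tmul, q.comul_eq (q.P1 _), sum_tmul]
  have h₂ : q.comul₂ q.Phi = ∑ a ∈ Finset.range q.np, ∑ i ∈ Finset.range (q.n (q.P2 a)),
      q.P1 a ⊗ₜ[k] (q.d1 (q.P2 a) i ⊗ₜ[k] (q.d2 (q.P2 a) i ⊗ₜ[k] q.P3 a)) := by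
    simp [Phi, comul₂_tmul, q.comul_eq (q.P2 _), sum_tmul, tmul_sum]
  have h₃ : q.comul₃ q.Phi =
      ∑ a ∈ Finset.range q.np, q.P1 a ⊗ₜ[k] (q.P2 a ⊗ₜ[k] q.comul (q.P3 a)) := by
    simp [Phi, comul₃_tmul]
  have h₄ : tmulOne q.Phi =
      ∑ a ∈ Finset.range q.np, q.P1 a ⊗ₜ[k] (q.P2 a ⊗ₜ[k] (q.P3 a ⊗ₜ[k] (1 : H))) := by
    simp [Phi, tmulOne_tmul]
  rw [h₁, h₂, h₃, h₄]
  exact q.pentagon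

theorem map_phiInv_mul_phi {B : Type} [Semiring B] [Algebra k B]
    (F : H ⊗[k] (H ⊗[k] H) →ₐ[k] B) : F q.PhiInv * F q.Phi = 1 := by
  rw [← map_mul, phiInv_mul_phi, map_one]

theorem map_phi_mul_phiInv {B : Type} [Semiring B] [Algebra k B]
    (F : H ⊗[k] (H ⊗[k] H) →ₐ[k] B) : F q.Phi * F q.PhiInv = 1 := by
  rw [← map_mul, phi_mul_phiInv, map_one]

theorem pentagon_phiInv :
    tmulOne q.PhiInv * q.comul₂ q.PhiInv * oneTmul q.PhiInv =
      q.comul₁ q.PhiInv * q.comul₃ q.PhiInv := by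
  have left : (tmulOne q.PhiInv * q.comul₂ q.PhiInv * oneTmul q.PhiInv) *
      (q.comul₃ q.Phi * q.comul₁ q.Phi) = 1 := by
    rw [comul₃_mul_comul₁_phi]
    have e₁ := q.map_phiInv_mul_phi (oneTmul (k := k) (H := H))
    have e₂ := q.map_phiInv_mul_phi q.comul₂
    have e₃ := q.map_phiInv_mul_phi (tmulOne (k := k) (H := H))
    simp only [mul_assoc_four]
    rw [← mul_assoc_four (oneTmul q.PhiInv), e₁, one_mul, ← mul_assoc_four (q.comul₂ q.PhiInv), e₂,
      one_mul, e₃]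
  have right : (q.comul₃ q.Phi * q.comul₁ q.Phi) *
      (q.comul₁ q.PhiInv * q.comul₃ q.PhiInv) = 1 := by
    rw [mul_assoc_four, ← mul_assoc_four (q.comul₁ q.Phi), map_phi_mul_phiInv, one_mul,
      map_phi_mul_phiInv]
  exact left_inv_eq_right_inv left right

/-! ### Counits of the associator -/

/-- `a ⊗ b ⊗ c ↦ ε(a) b ⊗ c` -/
def counit₁ : H ⊗[k] (H ⊗[k] H) →ₐ[k] H ⊗[k] H :=
  (Algebra.TensorProduct.lid k (H ⊗[k] H)).toAlgHom.comp
    (Algebra.TensorProduct.map q.counit (AlgHom.id k (H ⊗[k] H)))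

/-- `a ⊗ b ⊗ c ↦ ε(b) a ⊗ c` -/
def counit₂ : H ⊗[k] (H ⊗[k] H) →ₐ[k] H ⊗[k] H :=
  Algebra.TensorProduct.map (AlgHom.id k H)
    ((Algebra.TensorProduct.lid k H).toAlgHom.comp
      (Algebra.TensorProduct.map q.counit (AlgHom.id k H)))

/-- `a ⊗ b ⊗ c ↦ ε(c) a ⊗ b` -/
def counit₃ : H ⊗[k] (H ⊗[k] H) →ₐ[k] H ⊗[k] H :=
  Algebra.TensorProduct.map (AlgHom.id k H)
    ((Algebra.TensorProduct.rid k k H).toAlgHom.comp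
      (Algebra.TensorProduct.map (AlgHom.id k H) q.counit))

theorem counit₁_tmul (a : H) (x : H ⊗[k] H) : q.counit₁ (a ⊗ₜ x) = q.counit a • x := rfl

theorem counit₂_tmul (a b c : H) :
    q.counit₂ (a ⊗ₜ (b ⊗ₜ c)) = q.counit b • (a ⊗ₜ[k] c) :=
  tmul_smul (q.counit b) a c

theorem counit₃_tmul (a b c : H) :
    q.counit₃ (a ⊗ₜ (b ⊗ₜ c)) = q.counit c • (a ⊗ₜ[k] b) :=
  tmul_smul (q.counit c) a b

theorem lid_counit_comul (h : H) :
    TensorProduct.lid k H (TensorProduct.map q.counit.toLinearMap LinearMap.id (q.comul h)) =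
      h := by
  simpa [q.comul_eq h] using q.counit_left h

theorem rid_counit_comul (h : H) :
    TensorProduct.rid k H (TensorProduct.map LinearMap.id q.counit.toLinearMap (q.comul h)) =
      h := by
  simpa [q.comul_eq h] using q.counit_right h

theorem counit₂_phi : q.counit₂ q.Phi = 1 := by
  rw [Algebra.TensorProduct.one_def, ← q.counit_mid_phi]
  simp [Phi, counit₂_tmul]

/-- `a ⊗ b ⊗ c ⊗ d ↦ ε(b) a ⊗ c ⊗ d` -/
def counitSnd : H ⊗[k] (H ⊗[k] (H ⊗[k] H)) →ₐ[k] H ⊗[k] (H ⊗[k] H) :=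
  Algebra.TensorProduct.map (AlgHom.id k H) q.counit₁

/-- `a ⊗ b ⊗ c ⊗ d ↦ ε(c) a ⊗ b ⊗ d` -/
def counitThd : H ⊗[k] (H ⊗[k] (H ⊗[k] H)) →ₐ[k] H ⊗[k] (H ⊗[k] H) :=
  Algebra.TensorProduct.map (AlgHom.id k H) q.counit₂

theorem counitSnd_tmul (a : H) (x : H ⊗[k] (H ⊗[k] H)) :
    q.counitSnd (a ⊗ₜ x) = a ⊗ₜ q.counit₁ x := rfl

theorem counitThd_tmul (a : H) (x : H ⊗[k] (H ⊗[k] H)) :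
    q.counitThd (a ⊗ₜ x) = a ⊗ₜ q.counit₂ x := rfl

theorem counitSnd_comul₁ (x : H ⊗[k] (H ⊗[k] H)) : q.counitSnd (q.comul₁ x) = x := by
  induction x using induction_three with
  | add x y hx hy => simp only [map_add, hx, hy]
  | tmul a b c =>
    have key : ∀ t : H ⊗[k] H, q.counitSnd (TensorProduct.assoc k H H (H ⊗[k] H) (t ⊗ₜ (b ⊗ₜ c))) =
        TensorProduct.rid k H (TensorProduct.map LinearMap.id q.counit.toLinearMap t) ⊗ₜ
          (b ⊗ₜ c) := fun t => by
      induction t using induction_two with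
      | add x y hx hy => simp only [map_add, add_tmul, hx, hy]
      | tmul x y => simp [counitSnd_tmul, counit₁_tmul, smul_tmul]
    rw [comul₁_tmul, key, rid_counit_comul]

theorem counitThd_comul₃ (x : H ⊗[k] (H ⊗[k] H)) : q.counitThd (q.comul₃ x) = x := by
  induction x using induction_three with
  | add x y hx hy => simp only [map_add, hx, hy]
  | tmul a b c =>
    have key : ∀ t : H ⊗[k] H, q.counitThd (a ⊗ₜ (b ⊗ₜ t)) = a ⊗ₜ (b ⊗ₜ
        TensorProduct.lid k H (TensorProduct.map q.counit.toLinearMap LinearMap.id t)) :=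
      fun t => by
      induction t using induction_two with
      | add x y hx hy => simp only [map_add, tmul_add, hx, hy]
      | tmul x y => simp [counitThd_tmul, counit₂_tmul]
    rw [comul₃_tmul, key, lid_counit_comul]

theorem counitSnd_comul₂ (x : H ⊗[k] (H ⊗[k] H)) : q.counitSnd (q.comul₂ x) = x := by
  induction x using induction_three with
  | add x y hx hy => simp only [map_add, hx, hy]
  | tmul a b c =>
    have key : ∀ t : H ⊗[k] H, q.counitSnd (a ⊗ₜ TensorProduct.assoc k H H H (t ⊗ₜ c)) =
        a ⊗ₜ (TensorProduct.lid k H (TensorProduct.map q.counit.toLinearMap LinearMap.id t) ⊗ₜ c) :=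
      fun t => by
      induction t using induction_two with
      | add x y hx hy => simp only [map_add, tmul_add, add_tmul, hx, hy]
      | tmul x y => simp [counitSnd_tmul, counit₁_tmul, smul_tmul']
    rw [comul₂_tmul, key, lid_counit_comul]

theorem counitThd_comul₂ (x : H ⊗[k] (H ⊗[k] H)) : q.counitThd (q.comul₂ x) = x := by
  induction x using induction_three with
  | add x y hx hy => simp only [map_add, hx, hy]
  | tmul a b c =>
    have key : ∀ t : H ⊗[k] H, q.counitThd (a ⊗ₜ TensorProduct.assoc k H H H (t ⊗ₜ c)) =
        a ⊗ₜ (TensorProduct.rid k H (TensorProduct.map LinearMap.id q.counit.toLinearMap t) ⊗ₜ c) :=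
      fun t => by
      induction t using induction_two with
      | add x y hx hy => simp only [map_add, tmul_add, add_tmul, hx, hy]
      | tmul x y => simp [counitThd_tmul, counit₂_tmul, smul_tmul']
    rw [comul₂_tmul, key, rid_counit_comul]

theorem counitSnd_tmulOne (x : H ⊗[k] (H ⊗[k] H)) :
    q.counitSnd (tmulOne x) =
      Algebra.TensorProduct.map (AlgHom.id k H) (inl (k := k)) (q.counit₂ x) := by
  induction x using induction_three with
  | add x y hx hy => simp only [map_add, hx, hy]
  | tmul a b c => simp [tmulOne_tmul, counitSnd_tmul, counit₁_tmul, counit₂_tmul, inl_apply]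

theorem counitThd_oneTmul (x : H ⊗[k] (H ⊗[k] H)) :
    q.counitThd (oneTmul x) = 1 ⊗ₜ q.counit₂ x := rfl

theorem counitSnd_oneTmul (x : H ⊗[k] (H ⊗[k] H)) :
    q.counitSnd (oneTmul x) = 1 ⊗ₜ q.counit₁ x := rfl

theorem counitThd_tmulOne (x : H ⊗[k] (H ⊗[k] H)) :
    q.counitThd (tmulOne x) =
      Algebra.TensorProduct.map (AlgHom.id k H) (inl (k := k)) (q.counit₃ x) := by
  induction x using induction_three with
  | add x y hx hy => simp only [map_add, hx, hy]
  | tmul a b c => simp [tmulOne_tmul, counitThd_tmul, counit₂_tmul, counit₃_tmul, inl_apply]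

theorem counitThd_comul₁ (x : H ⊗[k] (H ⊗[k] H)) :
    q.counitThd (q.comul₁ x) = q.comulFst H (q.counit₂ x) := by
  induction x using induction_three with
  | add x y hx hy => simp only [map_add, hx, hy]
  | tmul a b c =>
    have key : ∀ t : H ⊗[k] H, q.counitThd (TensorProduct.assoc k H H (H ⊗[k] H) (t ⊗ₜ (b ⊗ₜ c))) =
        q.counit b • TensorProduct.assoc k H H H (t ⊗ₜ c) := fun t => by
      induction t using induction_two with
      | add x y hx hy => simp only [map_add, add_tmul, smul_add, hx, hy]
      | tmul x y => simp [counitThd_tmul, counit₂_tmul]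
    rw [comul₁_tmul, key, counit₂_tmul, map_smul, comulFst_tmul]

theorem counitSnd_comul₃ (x : H ⊗[k] (H ⊗[k] H)) :
    q.counitSnd (q.comul₃ x) = q.comulSnd (q.counit₂ x) := by
  induction x using induction_three with
  | add x y hx hy => simp only [map_add, hx, hy]
  | tmul a b c =>
    simp [comul₃_tmul, counitSnd_tmul, counit₁_tmul, counit₂_tmul, comulSnd_tmul]

theorem counit₁_phi : q.counit₁ q.Phi = 1 := by
  have e := congrArg q.counitSnd q.comul₃_mul_comul₁_phi
  simp only [map_mul, counitSnd_comul₃, counitSnd_comul₁, counitSnd_oneTmul, counitSnd_comul₂,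
    counitSnd_tmulOne, counit₂_phi, map_one, one_mul, mul_one] at e
  have e₀ := congrArg (fun x => q.counit₁ (x * q.PhiInv)) e
  simp only [mul_assoc, phi_mul_phiInv, mul_one, map_one] at e₀
  rw [counit₁_tmul, map_one, one_smul] at e₀
  exact e₀.symm

theorem counit₃_phi : q.counit₃ q.Phi = 1 := by
  have e := congrArg q.counitThd q.comul₃_mul_comul₁_phi
  simp only [map_mul, counitThd_comul₃, counitThd_comul₁, counitThd_oneTmul, counitThd_comul₂,
    counitThd_tmulOne, counit₂_phi, map_one, mul_one] at e
  rw [← Algebra.TensorProduct.one_def, one_mul] at e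
  have e₀ := congrArg (fun x => q.counit₃ (q.PhiInv * x)) e
  simp only [← mul_assoc, phiInv_mul_phi, one_mul, map_one] at e₀
  have key : ∀ x : H ⊗[k] H, q.counit₃
      (Algebra.TensorProduct.map (AlgHom.id k H) (inl (k := k)) x) = x := fun x => by
    induction x using induction_two with
    | add x y hx hy => simp only [map_add, hx, hy]
    | tmul a b => simp [inl_apply, counit₃_tmul]
  rw [key] at e₀
  exact e₀.symm

/-! ### Contractions of four tensor factors -/

/-- `Σ u (h₍₁₎ x) * v (h₍₂₎ y) = ε h • (u x * v y)` -/
def LeftInv (u v : H →ₗ[k] A) : Prop := ∀ h x y : H,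
  conv (u ∘ₗ LinearMap.mulRight k x) (v ∘ₗ LinearMap.mulRight k y) (q.comul h) =
    q.counit h • (u x * v y)

/-- `Σ u (x h₍₁₎) * v (y h₍₂₎) = ε h • (u x * v y)` -/
def RightInv (u v : H →ₗ[k] A) : Prop := ∀ h x y : H,
  conv (u ∘ₗ LinearMap.mulLeft k x) (v ∘ₗ LinearMap.mulLeft k y) (q.comul h) =
    q.counit h • (u x * v y)

/-- `a ⊗ b ⊗ c ⊗ d ↦ u a * (v b * (w c * z d))` -/
def conv₄ (u v w z : H →ₗ[k] A) : H ⊗[k] (H ⊗[k] (H ⊗[k] H)) →ₗ[k] A :=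
  conv u (conv v (conv w z))

theorem conv₄_tmul (u v w z : H →ₗ[k] A) (a b c d : H) :
    conv₄ u v w z (a ⊗ₜ (b ⊗ₜ (c ⊗ₜ d))) = u a * (v b * (w c * z d)) := rfl

variable {q} {u v w z : H →ₗ[k] A}

/-- `b ⊗ c ↦ 1 ⊗ 1 ⊗ b ⊗ c` -/
def insert₁ : H ⊗[k] H →ₐ[k] H ⊗[k] (H ⊗[k] (H ⊗[k] H)) :=
  Algebra.TensorProduct.includeRight.comp
    Algebra.TensorProduct.includeRight

theorem insert₁_tmul (b c : H) :
    insert₁ (b ⊗ₜ[k] c) = (1 : H) ⊗ₜ[k] (1 ⊗ₜ[k] (b ⊗ₜ[k] c)) := rfl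

theorem insert₁_one : insert₁ (1 : H ⊗[k] H) = 1 := insert₁.map_one'

theorem conv₄_comul₁_mul (huv : q.LeftInv u v) (Y : H ⊗[k] (H ⊗[k] H))
    (X : H ⊗[k] (H ⊗[k] (H ⊗[k] H))) :
    conv₄ u v w z (q.comul₁ Y * X) =
      conv₄ u v w z (insert₁ (q.counit₁ Y) * X) := by
  induction Y using induction_three with
  | add Y₁ Y₂ h₁ h₂ => simp only [map_add, add_mul_four, h₁, h₂]
  | tmul a b c =>
    induction X using induction_four with
    | add X₁ X₂ h₁ h₂ => simp only [map_add, mul_add_four, h₁, h₂]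
    | tmul x₁ x₂ x₃ x₄ =>
      have key : ∀ t : H ⊗[k] H, conv₄ u v w z
          ((TensorProduct.assoc k H H (H ⊗[k] H) (t ⊗ₜ (b ⊗ₜ c))) *
            (x₁ ⊗ₜ[k] (x₂ ⊗ₜ[k] (x₃ ⊗ₜ[k] x₄)))) =
          conv (u ∘ₗ LinearMap.mulRight k x₁) (v ∘ₗ LinearMap.mulRight k x₂) t *
            (w (b * x₃) * z (c * x₄)) :=
          fun t => by
        induction t using induction_two with
        | add s t hs ht =>
          simp only [add_tmul, map_add, add_mul, add_mul_four, hs, ht]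
        | tmul s t => simp [conv₄_tmul, mul_assoc]
      rw [comul₁_tmul, key, huv, counit₁_tmul, map_smul, insert₁_tmul]
      simp [smul_mul_four, conv₄_tmul, mul_assoc]

theorem conv₄_comul₁_phi_mul (huv : q.LeftInv u v)
    (X : H ⊗[k] (H ⊗[k] (H ⊗[k] H))) :
    conv₄ u v w z (q.comul₁ q.Phi * X) = conv₄ u v w z X := by
  rw [conv₄_comul₁_mul huv, counit₁_phi, insert₁_one, one_mul_four]

theorem conv₄_comul₁_phiInv_mul (huv : q.LeftInv u v)
    (X : H ⊗[k] (H ⊗[k] (H ⊗[k] H))) :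
    conv₄ u v w z (q.comul₁ q.PhiInv * X) = conv₄ u v w z X := by
  rw [← conv₄_comul₁_phi_mul huv, ← mul_assoc_four, map_phi_mul_phiInv, one_mul_four]

/-- `a ⊗ c ↦ a ⊗ 1 ⊗ 1 ⊗ c` -/
def insert₂ : H ⊗[k] H →ₐ[k] H ⊗[k] (H ⊗[k] (H ⊗[k] H)) :=
  Algebra.TensorProduct.map (AlgHom.id k H)
    (Algebra.TensorProduct.includeRight.comp Algebra.TensorProduct.includeRight)

theorem insert₂_tmul (a c : H) :
    insert₂ (a ⊗ₜ[k] c) = a ⊗ₜ[k] ((1 : H) ⊗ₜ[k] (1 ⊗ₜ[k] c)) := rfl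

theorem insert₂_one : insert₂ (1 : H ⊗[k] H) = 1 := insert₂.map_one'

theorem conv₄_comul₂_mul (huv : q.LeftInv v w) (Y : H ⊗[k] (H ⊗[k] H))
    (X : H ⊗[k] (H ⊗[k] (H ⊗[k] H))) :
    conv₄ u v w z (q.comul₂ Y * X) =
      conv₄ u v w z (insert₂ (q.counit₂ Y) * X) := by
  induction Y using induction_three with
  | add Y₁ Y₂ h₁ h₂ => simp only [map_add, add_mul_four, h₁, h₂]
  | tmul a b c =>
    induction X using induction_four with
    | add X₁ X₂ h₁ h₂ => simp only [map_add, mul_add_four, h₁, h₂]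
    | tmul x₁ x₂ x₃ x₄ =>
      have key : ∀ t : H ⊗[k] H, conv₄ u v w z
          ((a ⊗ₜ TensorProduct.assoc k H H H (t ⊗ₜ c)) * (x₁ ⊗ₜ[k] (x₂ ⊗ₜ[k] (x₃ ⊗ₜ[k] x₄)))) =
          u (a * x₁) *
            (conv (v ∘ₗ LinearMap.mulRight k x₂) (w ∘ₗ LinearMap.mulRight k x₃) t * z (c * x₄)) :=
          fun t => by
        induction t using induction_two with
        | add s t hs ht =>
          simp only [add_tmul, tmul_add, map_add, mul_add, add_mul, add_mul_four, hs, ht]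
        | tmul s t => simp [conv₄_tmul, mul_assoc]
      rw [comul₂_tmul, key, huv, counit₂_tmul, map_smul, insert₂_tmul]
      simp [smul_mul_four, conv₄_tmul, mul_assoc]

theorem conv₄_comul₂_phi_mul (huv : q.LeftInv v w)
    (X : H ⊗[k] (H ⊗[k] (H ⊗[k] H))) :
    conv₄ u v w z (q.comul₂ q.Phi * X) = conv₄ u v w z X := by
  rw [conv₄_comul₂_mul huv, counit₂_phi, insert₂_one, one_mul_four]

theorem conv₄_comul₂_phiInv_mul (huv : q.LeftInv v w)
    (X : H ⊗[k] (H ⊗[k] (H ⊗[k] H))) :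
    conv₄ u v w z (q.comul₂ q.PhiInv * X) = conv₄ u v w z X := by
  rw [← conv₄_comul₂_phi_mul huv, ← mul_assoc_four, map_phi_mul_phiInv, one_mul_four]

/-- `a ⊗ b ↦ a ⊗ b ⊗ 1 ⊗ 1` -/
def insert₃ : H ⊗[k] H →ₐ[k] H ⊗[k] (H ⊗[k] (H ⊗[k] H)) :=
  Algebra.TensorProduct.map (AlgHom.id k H)
    Algebra.TensorProduct.includeLeft

theorem insert₃_tmul (a b : H) :
    insert₃ (a ⊗ₜ[k] b) = a ⊗ₜ[k] (b ⊗ₜ[k] ((1 : H) ⊗ₜ[k] 1)) := rfl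

theorem insert₃_one : insert₃ (1 : H ⊗[k] H) = 1 := insert₃.map_one'

theorem conv₄_comul₃_mul (huv : q.LeftInv w z) (Y : H ⊗[k] (H ⊗[k] H))
    (X : H ⊗[k] (H ⊗[k] (H ⊗[k] H))) :
    conv₄ u v w z (q.comul₃ Y * X) =
      conv₄ u v w z (insert₃ (q.counit₃ Y) * X) := by
  induction Y using induction_three with
  | add Y₁ Y₂ h₁ h₂ => simp only [map_add, add_mul_four, h₁, h₂]
  | tmul a b c =>
    induction X using induction_four with
    | add X₁ X₂ h₁ h₂ => simp only [map_add, mul_add_four, h₁, h₂]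
    | tmul x₁ x₂ x₃ x₄ =>
      have key : ∀ t : H ⊗[k] H, conv₄ u v w z
          ((a ⊗ₜ (b ⊗ₜ t)) * (x₁ ⊗ₜ[k] (x₂ ⊗ₜ[k] (x₃ ⊗ₜ[k] x₄)))) =
          u (a * x₁) *
            (v (b * x₂) * conv (w ∘ₗ LinearMap.mulRight k x₃) (z ∘ₗ LinearMap.mulRight k x₄) t) :=
          fun t => by
        induction t using induction_two with
        | add s t hs ht =>
          simp only [tmul_add, map_add, mul_add, add_mul_four, hs, ht]
        | tmul s t => simp [conv₄_tmul]
      rw [comul₃_tmul, key, huv, counit₃_tmul, map_smul, insert₃_tmul]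
      simp [smul_mul_four, conv₄_tmul]

theorem conv₄_comul₃_phi_mul (huv : q.LeftInv w z)
    (X : H ⊗[k] (H ⊗[k] (H ⊗[k] H))) :
    conv₄ u v w z (q.comul₃ q.Phi * X) = conv₄ u v w z X := by
  rw [conv₄_comul₃_mul huv, counit₃_phi, insert₃_one, one_mul_four]

theorem conv₄_comul₃_phiInv_mul (huv : q.LeftInv w z)
    (X : H ⊗[k] (H ⊗[k] (H ⊗[k] H))) :
    conv₄ u v w z (q.comul₃ q.PhiInv * X) = conv₄ u v w z X := by
  rw [← conv₄_comul₃_phi_mul huv, ← mul_assoc_four, map_phi_mul_phiInv, one_mul_four]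

theorem conv₄_mul_comul₁ (huv : q.RightInv u v) (Y : H ⊗[k] (H ⊗[k] H))
    (X : H ⊗[k] (H ⊗[k] (H ⊗[k] H))) :
    conv₄ u v w z (X * q.comul₁ Y) =
      conv₄ u v w z (X * insert₁ (q.counit₁ Y)) := by
  induction Y using induction_three with
  | add Y₁ Y₂ h₁ h₂ => simp only [map_add, mul_add_four, h₁, h₂]
  | tmul a b c =>
    induction X using induction_four with
    | add X₁ X₂ h₁ h₂ => simp only [map_add, add_mul_four, h₁, h₂]
    | tmul x₁ x₂ x₃ x₄ =>
      have key : ∀ t : H ⊗[k] H, conv₄ u v w z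
          ((x₁ ⊗ₜ[k] (x₂ ⊗ₜ[k] (x₃ ⊗ₜ[k] x₄))) *
            (TensorProduct.assoc k H H (H ⊗[k] H) (t ⊗ₜ (b ⊗ₜ c)))) =
          conv (u ∘ₗ LinearMap.mulLeft k x₁) (v ∘ₗ LinearMap.mulLeft k x₂) t *
            (w (x₃ * b) * z (x₄ * c)) :=
          fun t => by
        induction t using induction_two with
        | add s t hs ht =>
          simp only [add_tmul, map_add, add_mul, mul_add_four, hs, ht]
        | tmul s t => simp [conv₄_tmul, mul_assoc]
      rw [comul₁_tmul, key, huv, counit₁_tmul, map_smul, insert₁_tmul]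
      simp [mul_smul_four, conv₄_tmul, mul_assoc]

theorem conv₄_mul_comul₁_phi (huv : q.RightInv u v)
    (X : H ⊗[k] (H ⊗[k] (H ⊗[k] H))) :
    conv₄ u v w z (X * q.comul₁ q.Phi) = conv₄ u v w z X := by
  rw [conv₄_mul_comul₁ huv, counit₁_phi, insert₁_one, mul_one_four]

theorem conv₄_mul_comul₁_phiInv (huv : q.RightInv u v)
    (X : H ⊗[k] (H ⊗[k] (H ⊗[k] H))) :
    conv₄ u v w z (X * q.comul₁ q.PhiInv) = conv₄ u v w z X := by
  rw [← conv₄_mul_comul₁_phi huv, mul_assoc_four, map_phiInv_mul_phi, mul_one_four]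

theorem conv₄_mul_comul₂ (huv : q.RightInv v w) (Y : H ⊗[k] (H ⊗[k] H))
    (X : H ⊗[k] (H ⊗[k] (H ⊗[k] H))) :
    conv₄ u v w z (X * q.comul₂ Y) =
      conv₄ u v w z (X * insert₂ (q.counit₂ Y)) := by
  induction Y using induction_three with
  | add Y₁ Y₂ h₁ h₂ => simp only [map_add, mul_add_four, h₁, h₂]
  | tmul a b c =>
    induction X using induction_four with
    | add X₁ X₂ h₁ h₂ => simp only [map_add, add_mul_four, h₁, h₂]
    | tmul x₁ x₂ x₃ x₄ =>
      have key : ∀ t : H ⊗[k] H, conv₄ u v w z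
          ((x₁ ⊗ₜ[k] (x₂ ⊗ₜ[k] (x₃ ⊗ₜ[k] x₄))) * (a ⊗ₜ TensorProduct.assoc k H H H (t ⊗ₜ c))) =
          u (x₁ * a) *
            (conv (v ∘ₗ LinearMap.mulLeft k x₂) (w ∘ₗ LinearMap.mulLeft k x₃) t * z (x₄ * c)) :=
          fun t => by
        induction t using induction_two with
        | add s t hs ht =>
          simp only [add_tmul, tmul_add, map_add, mul_add, add_mul, mul_add_four, hs, ht]
        | tmul s t => simp [conv₄_tmul, mul_assoc]
      rw [comul₂_tmul, key, huv, counit₂_tmul, map_smul, insert₂_tmul]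
      simp [mul_smul_four, conv₄_tmul, mul_assoc]

theorem conv₄_mul_comul₂_phi (huv : q.RightInv v w)
    (X : H ⊗[k] (H ⊗[k] (H ⊗[k] H))) :
    conv₄ u v w z (X * q.comul₂ q.Phi) = conv₄ u v w z X := by
  rw [conv₄_mul_comul₂ huv, counit₂_phi, insert₂_one, mul_one_four]

theorem conv₄_mul_comul₂_phiInv (huv : q.RightInv v w)
    (X : H ⊗[k] (H ⊗[k] (H ⊗[k] H))) :
    conv₄ u v w z (X * q.comul₂ q.PhiInv) = conv₄ u v w z X := by
  rw [← conv₄_mul_comul₂_phi huv, mul_assoc_four, map_phiInv_mul_phi, mul_one_four]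

theorem conv₄_mul_comul₃ (huv : q.RightInv w z) (Y : H ⊗[k] (H ⊗[k] H))
    (X : H ⊗[k] (H ⊗[k] (H ⊗[k] H))) :
    conv₄ u v w z (X * q.comul₃ Y) =
      conv₄ u v w z (X * insert₃ (q.counit₃ Y)) := by
  induction Y using induction_three with
  | add Y₁ Y₂ h₁ h₂ => simp only [map_add, mul_add_four, h₁, h₂]
  | tmul a b c =>
    induction X using induction_four with
    | add X₁ X₂ h₁ h₂ => simp only [map_add, add_mul_four, h₁, h₂]
    | tmul x₁ x₂ x₃ x₄ =>
      have key : ∀ t : H ⊗[k] H, conv₄ u v w z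
          ((x₁ ⊗ₜ[k] (x₂ ⊗ₜ[k] (x₃ ⊗ₜ[k] x₄))) * (a ⊗ₜ (b ⊗ₜ t))) =
          u (x₁ * a) *
            (v (x₂ * b) * conv (w ∘ₗ LinearMap.mulLeft k x₃) (z ∘ₗ LinearMap.mulLeft k x₄) t) :=
          fun t => by
        induction t using induction_two with
        | add s t hs ht =>
          simp only [tmul_add, map_add, mul_add, mul_add_four, hs, ht]
        | tmul s t => simp [conv₄_tmul]
      rw [comul₃_tmul, key, huv, counit₃_tmul, map_smul, insert₃_tmul]
      simp [mul_smul_four, conv₄_tmul]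

theorem conv₄_mul_comul₃_phi (huv : q.RightInv w z)
    (X : H ⊗[k] (H ⊗[k] (H ⊗[k] H))) :
    conv₄ u v w z (X * q.comul₃ q.Phi) = conv₄ u v w z X := by
  rw [conv₄_mul_comul₃ huv, counit₃_phi, insert₃_one, mul_one_four]

theorem conv₄_mul_comul₃_phiInv (huv : q.RightInv w z)
    (X : H ⊗[k] (H ⊗[k] (H ⊗[k] H))) :
    conv₄ u v w z (X * q.comul₃ q.PhiInv) = conv₄ u v w z X := by
  rw [← conv₄_mul_comul₃_phi huv, mul_assoc_four, map_phiInv_mul_phi, mul_one_four]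

theorem leftInv_of {u' v' : H →ₗ[k] A} {U V : H → A} {c : A}
    (hu : ∀ a x, u (a * x) = U x * u' a) (hv : ∀ b y, v (b * y) = v' b * V y)
    (hc : ∀ h, conv u' v' (q.comul h) = q.counit h • c)
    (huv : ∀ x y, U x * c * V y = u x * v y) : q.LeftInv u v := fun h x y => by
  have key : ∀ t : H ⊗[k] H,
      conv (u ∘ₗ LinearMap.mulRight k x) (v ∘ₗ LinearMap.mulRight k y) t =
        U x * conv u' v' t * V y := fun t => by
    induction t using induction_two with
    | add s t hs ht => simp only [map_add, mul_add, add_mul, hs, ht]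
    | tmul a b => simp [hu, hv, mul_assoc]
  rw [key, hc, ← huv, mul_smul_comm, smul_mul_assoc]

theorem rightInv_of {u' v' : H →ₗ[k] A} {U V : H → A} {c : A}
    (hu : ∀ x a, u (x * a) = U x * u' a) (hv : ∀ y b, v (y * b) = v' b * V y)
    (hc : ∀ h, conv u' v' (q.comul h) = q.counit h • c)
    (huv : ∀ x y, U x * c * V y = u x * v y) : q.RightInv u v := fun h x y => by
  have key : ∀ t : H ⊗[k] H,
      conv (u ∘ₗ LinearMap.mulLeft k x) (v ∘ₗ LinearMap.mulLeft k y) t =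
        U x * conv u' v' t * V y := fun t => by
    induction t using induction_two with
    | add s t hs ht => simp only [map_add, mul_add, add_mul, hs, ht]
    | tmul a b => simp [hu, hv, mul_assoc]
  rw [key, hc, ← huv, mul_smul_comm, smul_mul_assoc]

variable (q)

theorem conv_alpha (F : H →ₐ[k] A) (h : H) :
    conv (F.toLinearMap ∘ₗ q.S) (F.toLinearMap ∘ₗ LinearMap.mulLeft k q.alpha) (q.comul h) =
      q.counit h • F q.alpha := by
  rw [← map_smul, ← q.antipode_alpha h]
  simp [q.comul_eq h, mul_assoc]

theorem conv_beta (F : H →ₐ[k] A) (h : H) :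
    conv (F.toLinearMap ∘ₗ LinearMap.mulRight k q.beta) (F.toLinearMap ∘ₗ q.S) (q.comul h) =
      q.counit h • F q.beta := by
  rw [← map_smul, ← q.antipode_beta h]
  simp [q.comul_eq h]

theorem leftInv_alpha (F : H →ₐ[k] A) :
    q.LeftInv (F.toLinearMap ∘ₗ q.S) (F.toLinearMap ∘ₗ LinearMap.mulLeft k q.alpha) :=
  leftInv_of (U := fun x => F (q.S x)) (V := F) (by simp [q.S_mul]) (by simp [mul_assoc])
    (q.conv_alpha F) (by simp [mul_assoc])

theorem rightInv_beta (F : H →ₐ[k] A) :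
    q.RightInv (F.toLinearMap ∘ₗ LinearMap.mulRight k q.beta) (F.toLinearMap ∘ₗ q.S) :=
  rightInv_of (U := F) (V := fun x => F (q.S x)) (by simp [mul_assoc]) (by simp [q.S_mul])
    (q.conv_beta F) (by simp [mul_assoc])

/-! ### The elements `p^R` and `q^L` -/

/-- `x ⊗ y ⊗ z ↦ x ⊗ y β S(z)` -/
def pFun : H ⊗[k] (H ⊗[k] H) →ₗ[k] H ⊗[k] H :=
  conv inl.toLinearMap (conv (inr.toLinearMap ∘ₗ LinearMap.mulRight k q.beta)
    (inr.toLinearMap ∘ₗ q.S))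

theorem pFun_tmul (x y z : H) :
    q.pFun (x ⊗ₜ (y ⊗ₜ z)) = inl x * (inr (y * q.beta) * inr (q.S z)) := rfl

theorem pFun_phiInv : q.pFun q.PhiInv = q.pRE := by
  simp [PhiInv, pRE, pR1, pR2, pFun_tmul, inl_apply, inr_apply]

/-- `x ⊗ y ⊗ z ↦ S(x) α y ⊗ z` -/
def qFun : H ⊗[k] (H ⊗[k] H) →ₗ[k] H ⊗[k] H :=
  conv (inl.toLinearMap ∘ₗ q.S) (conv (inl.toLinearMap ∘ₗ LinearMap.mulLeft k q.alpha)
    inr.toLinearMap)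

theorem qFun_tmul (x y z : H) :
    q.qFun (x ⊗ₜ (y ⊗ₜ z)) = inl (q.S x) * (inl (q.alpha * y) * inr z) := rfl

theorem qFun_phiInv : q.qFun q.PhiInv = q.qLE := by
  simp [PhiInv, qLE, qL1, qL2, qFun_tmul, inl_apply, inr_apply, mul_assoc]

/-- `a ⊗ b ↦ Δ(a) p^R (1 ⊗ S(b))` -/
def comulP : H ⊗[k] H →ₗ[k] H ⊗[k] H :=
  conv (LinearMap.mulRight k q.pRE ∘ₗ q.comul.toLinearMap) (inr.toLinearMap ∘ₗ q.S)

theorem comulP_tmul (a b : H) : q.comulP (a ⊗ₜ b) = q.comul a * q.pRE * inr (q.S b) := rfl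

/-- `a ⊗ b ↦ (S(a) ⊗ 1) q^L Δ(b)` -/
def comulQ : H ⊗[k] H →ₗ[k] H ⊗[k] H :=
  conv (inl.toLinearMap ∘ₗ q.S) (LinearMap.mulLeft k q.qLE ∘ₗ q.comul.toLinearMap)

theorem comulQ_tmul (a b : H) : q.comulQ (a ⊗ₜ b) = inl (q.S a) * (q.qLE * q.comul b) := rfl

theorem comulP_comul (h : H) : q.comulP (q.comul h) = q.pRE * inl h := by
  have left : ∀ t X, q.pFun (q.comulFst H t * X) =
      conv (LinearMap.mulRight k (q.pFun X) ∘ₗ q.comul.toLinearMap) (inr.toLinearMap ∘ₗ q.S) t :=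
      fun t X => by
    induction t using induction_two with
    | add s t hs ht => simp only [map_add, add_mul, hs, ht]
    | tmul a b =>
      induction X using induction_three with
      | add X Y hX hY => simp_all [mul_add, add_mul]
      | tmul x y z =>
        rw [comulFst_tmul]
        simp only [conv_tmul, LinearMap.comp_apply, AlgHom.toLinearMap_apply,
          LinearMap.mulRight_apply]
        generalize q.comul a = t
        induction t using induction_two with
        | add s t hs ht => simp only [map_add, add_tmul, add_mul, hs, ht]
        | tmul s t =>
          simp [pFun_tmul, inl_apply, inr_apply, q.S_mul, mul_assoc]
  have right : ∀ t X, q.pFun (X * q.comulSnd t) =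
      q.pFun X * inl (TensorProduct.rid k H
        (TensorProduct.map LinearMap.id q.counit.toLinearMap t)) := fun t X => by
    induction t using induction_two with
    | add s t hs ht => simp only [map_add, mul_add, hs, ht]
    | tmul a b =>
      induction X using induction_three with
      | add X Y hX hY => simp_all [add_mul]
      | tmul x y z =>
        have key : ∀ t : H ⊗[k] H, q.pFun (x ⊗ₜ (y ⊗ₜ z) * a ⊗ₜ t) =
            inl (x * a) * (inr y * conv ((inr (k := k)).toLinearMap ∘ₗ LinearMap.mulRight k q.beta)
              (inr.toLinearMap ∘ₗ q.S) t * inr (q.S z)) := fun t => by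
          induction t using induction_two with
          | add s t hs ht => simp only [map_add, tmul_add, mul_add, add_mul, hs, ht]
          | tmul s t => simp [pFun_tmul, q.S_mul, mul_assoc]
        rw [comulSnd_tmul, key, conv_beta]
        simp [pFun_tmul, mul_assoc, inr_mul_inl, inr_mul_inl_assoc]
  have e := congrArg q.pFun (q.phiInv_mul_comulSnd h)
  rw [left, right, rid_counit_comul, pFun_phiInv] at e
  exact e.symm

theorem comulQ_comul (h : H) : q.comulQ (q.comul h) = inr h * q.qLE := by
  have left : ∀ t X, q.qFun (q.comulFst H t * X) =
      inr (TensorProduct.lid k H (TensorProduct.map q.counit.toLinearMap LinearMap.id t)) *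
        q.qFun X := fun t X => by
    induction t using induction_two with
    | add s t hs ht => simp only [map_add, add_mul, hs, ht]
    | tmul a b =>
      induction X using induction_three with
      | add X Y hX hY => simp_all [mul_add]
      | tmul x y z =>
        have key : ∀ t : H ⊗[k] H, q.qFun (TensorProduct.assoc k H H H (t ⊗ₜ b) * x ⊗ₜ (y ⊗ₜ z)) =
            inl (q.S x) * conv ((inl (k := k)).toLinearMap ∘ₗ q.S)
              (inl.toLinearMap ∘ₗ LinearMap.mulLeft k q.alpha) t * (inl y * inr (b * z)) :=
            fun t => by
          induction t using induction_two with
          | add s t hs ht => simp only [map_add, add_tmul, mul_add, add_mul, hs, ht]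
          | tmul s t => simp [qFun_tmul, q.S_mul, mul_assoc]
        rw [comulFst_tmul, key, conv_alpha]
        simp [qFun_tmul, mul_assoc, inr_mul_inl_assoc]
  have right : ∀ t X, q.qFun (X * q.comulSnd t) =
      conv (inl.toLinearMap ∘ₗ q.S) (LinearMap.mulLeft k (q.qFun X) ∘ₗ q.comul.toLinearMap) t :=
      fun t X => by
    induction t using induction_two with
    | add s t hs ht => simp only [map_add, mul_add, hs, ht]
    | tmul a b =>
      induction X using induction_three with
      | add X Y hX hY => simp_all [mul_add, add_mul]
      | tmul x y z =>
        rw [comulSnd_tmul]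
        simp only [conv_tmul, LinearMap.comp_apply, AlgHom.toLinearMap_apply,
          LinearMap.mulLeft_apply]
        generalize q.comul b = t
        induction t using induction_two with
        | add s t hs ht => simp only [map_add, tmul_add, mul_add, hs, ht]
        | tmul s t =>
          simp [qFun_tmul, inl_apply, inr_apply, q.S_mul, mul_assoc]
  have e := congrArg q.qFun (q.phiInv_mul_comulSnd h)
  rw [left, right, lid_counit_comul, qFun_phiInv] at e
  exact e

/-! ### The map `a ⊗ b ↦ S(b) ⊗ S(a)` -/

theorem sswap_tmul (a b : H) : q.sswap (a ⊗ₜ b) = inl (q.S b) * inr (q.S a) :=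
  (inl_mul_inr _ _).symm

theorem sswap_mul (x y : H ⊗[k] H) : q.sswap (x * y) = q.sswap y * q.sswap x := by
  induction x using induction_two with
  | add x x' hx hx' => simp only [add_mul, mul_add, map_add, hx, hx']
  | tmul a b =>
    induction y using induction_two with
    | add y y' hy hy' => simp only [add_mul, mul_add, map_add, hy, hy']
    | tmul c d => simp [sswap, q.S_mul]

theorem sswap_sswapInv (x : H ⊗[k] H) : q.sswap (q.sswapInv x) = x := by
  induction x using induction_two with
  | add x y hx hy => simp only [map_add, hx, hy]
  | tmul a b => simp [sswap, sswapInv, q.S_Sinv]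

theorem sswap_injective : Function.Injective q.sswap := by
  refine Function.LeftInverse.injective (g := q.sswapInv) fun x => ?_
  induction x using induction_two with
  | add x y hx hy => simp only [map_add, hx, hy]
  | tmul a b => simp [sswap, sswapInv, q.Sinv_S]

/-- The linear map underlying `scop`. -/
def scopₗ : H →ₗ[k] H ⊗[k] H := q.sswap ∘ₗ q.comul.toLinearMap

theorem scopₗ_apply (h : H) : q.scopₗ h = q.sswap (q.comul h) := rfl

theorem scop_eq (h : H) : q.scop h = q.scopₗ h := by
  rw [scopₗ_apply, q.comul_eq h]
  simp [scop, sswap]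

theorem scopₗ_mul (a b : H) : q.scopₗ (a * b) = q.scopₗ b * q.scopₗ a := by
  simp only [scopₗ_apply, map_mul, sswap_mul]

theorem scopₗ_one : q.scopₗ 1 = 1 := by
  rw [scopₗ_apply, map_one, Algebra.TensorProduct.one_def, sswap_tmul, q.S_one, map_one, map_one,
    one_mul, Algebra.TensorProduct.one_def]

/-! ### The elements `𝕒` and `𝕓` -/

/-- `a ⊗ b ⊗ c ↦ (S(b) ⊗ S(a) α) q^L Δ(c)` -/
def aFun : H ⊗[k] (H ⊗[k] H) →ₗ[k] H ⊗[k] H :=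
  conv (inr.toLinearMap ∘ₗ LinearMap.mulRight k q.alpha ∘ₗ q.S) q.comulQ

theorem aFun_tmul (a b c : H) :
    q.aFun (a ⊗ₜ (b ⊗ₜ c)) =
      inr (q.S a * q.alpha) * (inl (q.S b) * (q.qLE * q.comul c)) := rfl

theorem aFun_phi : q.aFun q.Phi = q.aEl := by
  simp only [Phi, aEl, map_sum, aFun_tmul, q.comul_eq (q.P3 _), qLE, qL1, qL2, Finset.sum_mul,
    Finset.mul_sum]
  refine Finset.sum_congr rfl fun a _ => ?_
  rw [Finset.sum_comm]
  simp [inl_apply, inr_apply, q.S_mul, mul_assoc]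

/-- `a ⊗ b ⊗ c ↦ Δ(a) p^R (β S(c) ⊗ S(b))` -/
def bFun : H ⊗[k] (H ⊗[k] H) →ₗ[k] H ⊗[k] H :=
  conv (LinearMap.mulRight k q.pRE ∘ₗ q.comul.toLinearMap)
    (conv (inr.toLinearMap ∘ₗ q.S) (inl.toLinearMap ∘ₗ LinearMap.mulLeft k q.beta ∘ₗ q.S))

theorem bFun_tmul (a b c : H) :
    q.bFun (a ⊗ₜ (b ⊗ₜ c)) =
      q.comul a * q.pRE * (inr (q.S b) * inl (q.beta * q.S c)) := rfl

theorem bFun_phi : q.bFun q.Phi = q.bEl := by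
  simp only [Phi, bEl, map_sum, bFun_tmul, q.comul_eq (q.P1 _), pRE, pR1, pR2, Finset.sum_mul,
    Finset.mul_sum]
  refine Finset.sum_congr rfl fun a _ => ?_
  simp [inl_apply, inr_apply, q.S_mul, mul_assoc]

theorem phi_mul_comulFst (h : H) :
    q.Phi * q.comulFst H (q.comul h) = q.comulSnd (q.comul h) * q.Phi := by
  have e := congrArg (fun x => q.Phi * x * q.Phi) (q.phiInv_mul_comulSnd h)
  simp only [mul_assoc, phiInv_mul_phi, mul_one] at e
  rw [← mul_assoc, phi_mul_phiInv, one_mul] at e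
  exact e.symm

/-- `a ⊗ b ↦ (S ⊗ S)(Δ^cop a) 𝕒 Δ(b)` -/
def sandwichA : H ⊗[k] H →ₗ[k] H ⊗[k] H :=
  conv (LinearMap.mulRight k q.aEl ∘ₗ q.scopₗ) q.comul.toLinearMap

theorem sandwichA_tmul (a b : H) :
    q.sandwichA (a ⊗ₜ b) = q.scopₗ a * q.aEl * q.comul b := rfl

/-- `a ⊗ b ↦ Δ(a) 𝕓 (S ⊗ S)(Δ^cop b)` -/
def sandwichB : H ⊗[k] H →ₗ[k] H ⊗[k] H :=
  conv q.comul.toLinearMap (LinearMap.mulLeft k q.bEl ∘ₗ q.scopₗ)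

theorem sandwichB_tmul (a b : H) :
    q.sandwichB (a ⊗ₜ b) = q.comul a * (q.bEl * q.scopₗ b) := rfl

theorem sandwichA_comul (h : H) : q.sandwichA (q.comul h) = q.counit h • q.aEl := by
  have left : ∀ t X, q.aFun (X * q.comulFst H t) =
      conv (LinearMap.mulRight k (q.aFun X) ∘ₗ q.scopₗ) q.comul.toLinearMap t := fun t X => by
    induction t using induction_two with
    | add s t hs ht => simp only [map_add, mul_add, hs, ht]
    | tmul a b =>
      induction X using induction_three with
      | add X Y hX hY => simp_all [mul_add, add_mul]
      | tmul x y z =>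
        rw [comulFst_tmul]
        simp only [conv_tmul, LinearMap.comp_apply, AlgHom.toLinearMap_apply,
          LinearMap.mulRight_apply, scopₗ_apply]
        generalize q.comul a = t
        induction t using induction_two with
        | add s t hs ht => simp only [map_add, add_tmul, mul_add, add_mul, hs, ht]
        | tmul s t =>
          simp [aFun_tmul, sswap_tmul, q.S_mul, mul_assoc, inr_mul_inl_assoc]
  have right : ∀ X, q.aFun (q.comulSnd (q.comul h) * X) = q.counit h • q.aFun X := fun X => by
    induction X using induction_three with
    | add X Y hX hY => simp only [map_add, mul_add, smul_add, hX, hY]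
    | tmul x y z =>
      have inner : ∀ a t, q.aFun (a ⊗ₜ t * x ⊗ₜ (y ⊗ₜ z)) =
          inr (q.S x * q.S a * q.alpha) * (inl (q.S y) * (q.comulQ t * q.comul z)) :=
          fun a t => by
        induction t using induction_two with
        | add s t hs ht => simp only [map_add, tmul_add, mul_add, add_mul, hs, ht]
        | tmul s t => simp [aFun_tmul, comulQ_tmul, q.S_mul, mul_assoc]
      have key : ∀ t, q.aFun (q.comulSnd t * x ⊗ₜ (y ⊗ₜ z)) =
          inr (q.S x) * (conv ((inr (k := k)).toLinearMap ∘ₗ q.S)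
            (inr.toLinearMap ∘ₗ LinearMap.mulLeft k q.alpha) t) *
              (inl (q.S y) * (q.qLE * q.comul z)) := fun t => by
        induction t using induction_two with
        | add s t hs ht => simp only [map_add, mul_add, add_mul, hs, ht]
        | tmul s t =>
          rw [comulSnd_tmul, inner, comulQ_comul]
          simp [mul_assoc, inr_mul_inl_assoc]
      rw [key, conv_alpha]
      simp [aFun_tmul, mul_assoc]
  have e := congrArg q.aFun (q.phi_mul_comulFst h)
  rw [left, right, aFun_phi] at e
  exact e

theorem sandwichB_comul (h : H) : q.sandwichB (q.comul h) = q.counit h • q.bEl := by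
  have left : ∀ t X, q.bFun (q.comulSnd t * X) =
      conv q.comul.toLinearMap (LinearMap.mulLeft k (q.bFun X) ∘ₗ q.scopₗ) t := fun t X => by
    induction t using induction_two with
    | add s t hs ht => simp only [map_add, add_mul, hs, ht]
    | tmul a b =>
      induction X using induction_three with
      | add X Y hX hY => simp_all [mul_add, add_mul]
      | tmul x y z =>
        rw [comulSnd_tmul]
        simp only [conv_tmul, LinearMap.comp_apply, AlgHom.toLinearMap_apply,
          LinearMap.mulLeft_apply, scopₗ_apply]
        generalize q.comul b = t
        induction t using induction_two with
        | add s t hs ht => simp only [map_add, tmul_add, mul_add, add_mul, hs, ht]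
        | tmul s t =>
          simp [bFun_tmul, sswap_tmul, q.S_mul, mul_assoc, inr_mul_inl, inr_mul_inl_assoc]
  have right : ∀ X, q.bFun (X * q.comulFst H (q.comul h)) = q.counit h • q.bFun X := fun X => by
    induction X using induction_three with
    | add X Y hX hY => simp only [map_add, add_mul, smul_add, hX, hY]
    | tmul x y z =>
      have inner : ∀ t b, q.bFun (x ⊗ₜ (y ⊗ₜ z) * TensorProduct.assoc k H H H (t ⊗ₜ b)) =
          q.comul x * q.comulP t * (inr (q.S y) * inl (q.beta * (q.S b * q.S z))) :=
          fun t b => by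
        induction t using induction_two with
        | add s t hs ht => simp only [map_add, add_tmul, mul_add, add_mul, hs, ht]
        | tmul s t =>
          simp [bFun_tmul, comulP_tmul, q.S_mul, mul_assoc]
      have key : ∀ t, q.bFun (x ⊗ₜ (y ⊗ₜ z) * q.comulFst H t) =
          q.comul x * q.pRE * (inr (q.S y) * (conv ((inl (k := k)).toLinearMap ∘ₗ
            LinearMap.mulRight k q.beta) (inl.toLinearMap ∘ₗ q.S) t * inl (q.S z))) :=
          fun t => by
        induction t using induction_two with
        | add s t hs ht => simp only [map_add, mul_add, add_mul, hs, ht]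
        | tmul s t =>
          rw [comulFst_tmul, inner, comulP_comul]
          simp [mul_assoc, inr_mul_inl_assoc, inr_mul_inl]
      rw [key, conv_beta]
      simp [bFun_tmul, mul_assoc]
  have e := congrArg q.bFun (q.phi_mul_comulFst h)
  rw [left, right, bFun_phi] at e
  exact e.symm

/-! ### The Drinfeld twist -/

theorem sandwichA_pRE : q.sandwichA q.pRE = q.twist := by
  simp [pRE, twist, sandwichA_tmul, scop_eq]

theorem sandwichB_qLE : q.sandwichB q.qLE = q.twistInv := by
  simp [qLE, twistInv, sandwichB_tmul, scop_eq, mul_assoc]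

theorem scopₗ_mul_twist (h : H) : q.scopₗ h * q.twist = q.twist * q.comul (q.S h) := by
  have left : ∀ X, q.sandwichA (X * inl h) = q.scopₗ h * q.sandwichA X := fun X => by
    induction X using induction_two with
    | add X Y hX hY => simp only [map_add, mul_add, add_mul, hX, hY]
    | tmul x y => simp [inl_apply, sandwichA_tmul, scopₗ_mul, mul_assoc]
  have inner : ∀ a b X, q.sandwichA (q.comul a * X * inr b) =
      q.counit a • (q.sandwichA X * q.comul b) := fun a b X => by
    induction X using induction_two with
    | add X Y hX hY => simp only [map_add, mul_add, add_mul, smul_add, hX, hY]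
    | tmul x y =>
      have key : ∀ t, q.sandwichA (t * x ⊗ₜ y * inr b) =
          q.scopₗ x * q.sandwichA t * q.comul (y * b) := fun t => by
        induction t using induction_two with
        | add s t hs ht => simp only [map_add, mul_add, add_mul, hs, ht]
        | tmul s t => simp [inr_apply, sandwichA_tmul, scopₗ_mul, mul_assoc]
      rw [key, sandwichA_comul]
      simp [sandwichA_tmul, mul_assoc]
  have right : ∀ t, q.sandwichA (q.comulP t) = q.twist * q.comul (q.S
      (TensorProduct.lid k H (TensorProduct.map q.counit.toLinearMap LinearMap.id t))) :=
      fun t => by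
    induction t using induction_two with
    | add s t hs ht => simp only [map_add, mul_add, hs, ht]
    | tmul a b =>
      rw [comulP_tmul, inner, sandwichA_pRE]
      simp
  rw [← sandwichA_pRE, ← left, ← comulP_comul, right, lid_counit_comul, sandwichA_pRE]

theorem twistInv_mul_scopₗ (h : H) :
    q.twistInv * q.scopₗ h = q.comul (q.S h) * q.twistInv := by
  have left : ∀ X, q.sandwichB (inr h * X) = q.sandwichB X * q.scopₗ h := fun X => by
    induction X using induction_two with
    | add X Y hX hY => simp only [map_add, mul_add, add_mul, hX, hY]
    | tmul x y => simp [inr_apply, sandwichB_tmul, scopₗ_mul, mul_assoc]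
  have inner : ∀ a b X, q.sandwichB (inl a * (X * q.comul b)) =
      q.counit b • (q.comul a * q.sandwichB X) := fun a b X => by
    induction X using induction_two with
    | add X Y hX hY => simp only [map_add, mul_add, add_mul, smul_add, hX, hY]
    | tmul x y =>
      have key : ∀ t, q.sandwichB (inl a * (x ⊗ₜ y * t)) =
          q.comul (a * x) * (q.sandwichB t * q.scopₗ y) := fun t => by
        induction t using induction_two with
        | add s t hs ht => simp only [map_add, mul_add, add_mul, hs, ht]
        | tmul s t => simp [inl_apply, sandwichB_tmul, scopₗ_mul, mul_assoc]
      rw [key, sandwichB_comul]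
      simp [sandwichB_tmul, mul_assoc]
  have right : ∀ t, q.sandwichB (q.comulQ t) = q.comul (q.S
      (TensorProduct.rid k H (TensorProduct.map LinearMap.id q.counit.toLinearMap t))) *
        q.twistInv := fun t => by
    induction t using induction_two with
    | add s t hs ht => simp only [map_add, add_mul, hs, ht]
    | tmul a b =>
      rw [comulQ_tmul, inner, sandwichB_qLE]
      simp
  rw [← sandwichB_qLE, ← left, ← comulQ_comul, right, rid_counit_comul, sandwichB_qLE]

theorem conv_phi :
    conv (LinearMap.mulRight k q.beta) (conv q.S (LinearMap.mulLeft k q.alpha)) q.Phi = 1 := by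
  rw [← q.nondeg_1]
  simp [Phi, mul_assoc]

theorem twist_mul_comul_alpha : q.twist * q.comul q.alpha = q.aEl := by
  let K := conv₄ (LinearMap.mulRight k q.aEl ∘ₗ q.scopₗ)
    (q.comul.toLinearMap ∘ₗ LinearMap.mulRight k q.beta) (q.comul.toLinearMap ∘ₗ q.S)
    (q.comul.toLinearMap ∘ₗ LinearMap.mulLeft k q.alpha)
  have leftInv : q.LeftInv (LinearMap.mulRight k q.aEl ∘ₗ q.scopₗ)
      (q.comul.toLinearMap ∘ₗ LinearMap.mulRight k q.beta) :=
    leftInv_of (U := q.scopₗ) (V := fun y => q.comul (y * q.beta))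
      (by simp [scopₗ_mul, mul_assoc]) (by simp [mul_assoc]) q.sandwichA_comul (by simp)
  have tmulOne_eq : ∀ X, K (tmulOne X) = q.sandwichA (q.pFun X) * q.comul q.alpha := fun X => by
    induction X using induction_three with
    | add X Y hX hY => simp only [map_add, add_mul, hX, hY]
    | tmul x y z =>
      simp [K, tmulOne_tmul, conv₄_tmul, pFun_tmul, inl_apply, inr_apply, sandwichA_tmul, mul_assoc]
  have oneTmul_eq : ∀ X, K (oneTmul X) = q.aEl * q.comul
      (conv (LinearMap.mulRight k q.beta) (conv q.S (LinearMap.mulLeft k q.alpha)) X) :=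
      fun X => by
    induction X using induction_three with
    | add X Y hX hY => simp only [map_add, mul_add, hX, hY]
    | tmul x y z => simp [K, oneTmul_apply, conv₄_tmul, scopₗ_one, mul_assoc]
  have e : tmulOne q.PhiInv * q.comul₂ q.PhiInv =
      q.comul₁ q.PhiInv * (q.comul₃ q.PhiInv * oneTmul q.Phi) := by
    rw [← mul_assoc_four, ← pentagon_phiInv, mul_assoc_four _ (oneTmul q.PhiInv),
      map_phiInv_mul_phi, mul_one_four]
  have e₀ := congrArg K e
  rw [conv₄_mul_comul₂_phiInv (q.rightInv_beta q.comul), conv₄_comul₁_phiInv_mul leftInv,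
    conv₄_comul₃_phiInv_mul (q.leftInv_alpha q.comul), tmulOne_eq, oneTmul_eq, conv_phi,
    pFun_phiInv, sandwichA_pRE, map_one, mul_one] at e₀
  exact e₀

theorem comul_beta_mul_twistInv : q.comul q.beta * q.twistInv = q.bEl := by
  let K := conv₄ (q.comul.toLinearMap ∘ₗ LinearMap.mulRight k q.beta) (q.comul.toLinearMap ∘ₗ q.S)
    (q.comul.toLinearMap ∘ₗ LinearMap.mulLeft k q.alpha) (LinearMap.mulLeft k q.bEl ∘ₗ q.scopₗ)
  have rightInv : q.RightInv (q.comul.toLinearMap ∘ₗ LinearMap.mulLeft k q.alpha)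
      (LinearMap.mulLeft k q.bEl ∘ₗ q.scopₗ) :=
    rightInv_of (U := fun x => q.comul (q.alpha * x)) (V := q.scopₗ)
      (by simp [mul_assoc]) (by simp [scopₗ_mul, mul_assoc]) q.sandwichB_comul
      (by simp [mul_assoc])
  have oneTmul_eq : ∀ X, K (oneTmul X) = q.comul q.beta * q.sandwichB (q.qFun X) := fun X => by
    induction X using induction_three with
    | add X Y hX hY => simp only [map_add, mul_add, hX, hY]
    | tmul x y z =>
      simp [K, oneTmul_apply, conv₄_tmul, qFun_tmul, inl_apply, inr_apply, sandwichB_tmul,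
        mul_assoc]
  have tmulOne_eq : ∀ X, K (tmulOne X) = q.comul
      (conv (LinearMap.mulRight k q.beta) (conv q.S (LinearMap.mulLeft k q.alpha)) X) * q.bEl :=
      fun X => by
    induction X using induction_three with
    | add X Y hX hY => simp only [map_add, add_mul, hX, hY]
    | tmul x y z => simp [K, tmulOne_tmul, conv₄_tmul, scopₗ_one, mul_assoc]
  have e : q.comul₂ q.PhiInv * oneTmul q.PhiInv =
      tmulOne q.Phi * q.comul₁ q.PhiInv * q.comul₃ q.PhiInv := by
    rw [mul_assoc_four, ← pentagon_phiInv, ← mul_assoc_four, ← mul_assoc_four,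
      map_phi_mul_phiInv, one_mul_four]
  have e₀ := congrArg K e
  rw [conv₄_comul₂_phiInv_mul (q.leftInv_alpha q.comul), conv₄_mul_comul₃_phiInv rightInv,
    conv₄_mul_comul₁_phiInv (q.rightInv_beta q.comul), tmulOne_eq, oneTmul_eq, conv_phi,
    qFun_phiInv, sandwichB_qLE, map_one, one_mul] at e₀
  exact e₀

/-! ### The element `q^R` -/

/-- `a ⊗ b ⊗ c ↦ S(b) α c ⊗ S(a)` -/
def rFun : H ⊗[k] (H ⊗[k] H) →ₗ[k] H ⊗[k] H :=
  conv (inr.toLinearMap ∘ₗ q.S)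
    (conv (inl.toLinearMap ∘ₗ q.S) (inl.toLinearMap ∘ₗ LinearMap.mulLeft k q.alpha))

theorem rFun_tmul (a b c : H) :
    q.rFun (a ⊗ₜ (b ⊗ₜ c)) = inr (q.S a) * (inl (q.S b) * inl (q.alpha * c)) := rfl

theorem rFun_phi : q.rFun q.Phi = q.sswap q.qRE := by
  simp [Phi, qRE, qR1, qR2, rFun_tmul, sswap_tmul, q.S_mul, q.S_Sinv, mul_assoc, inr_mul_inl,
    inr_mul_inl_assoc]

/-- `a ⊗ b ⊗ c ↦ (S(a) ⊗ 1) q^L Δ(b) p^R (1 ⊗ S(c))` -/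
def middle : H ⊗[k] (H ⊗[k] H) →ₗ[k] H ⊗[k] H :=
  conv (inl.toLinearMap ∘ₗ q.S)
    (conv (LinearMap.mulLeft k q.qLE ∘ₗ q.comul.toLinearMap)
      (LinearMap.mulLeft k q.pRE ∘ₗ inr.toLinearMap ∘ₗ q.S))

theorem middle_tmul (a b c : H) :
    q.middle (a ⊗ₜ (b ⊗ₜ c)) =
      inl (q.S a) * ((q.qLE * q.comul b) * (q.pRE * inr (q.S c))) := rfl

theorem middle_phiInv : q.middle q.PhiInv = inl q.alpha * inr q.beta := by
  let K := conv₄ ((inl (k := k)).toLinearMap ∘ₗ q.S)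
    (inl.toLinearMap ∘ₗ LinearMap.mulLeft k q.alpha)
    (inr.toLinearMap ∘ₗ LinearMap.mulRight k q.beta) (inr.toLinearMap ∘ₗ q.S)
  have inner : ∀ a t c X Z,
      K (tmulOne X * a ⊗ₜ TensorProduct.assoc k H H H (t ⊗ₜ c) * oneTmul Z) =
        inl (q.S a) * ((q.qFun X * t) * (q.pFun Z * inr (q.S c))) := fun a t c X Z => by
    induction t using induction_two with
    | add s t hs ht =>
      simp only [map_add, add_tmul, tmul_add, mul_add, add_mul, mul_add_four, add_mul_four, hs, ht]
    | tmul s t =>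
      induction X using induction_three with
      | add X Y hX hY => simp only [map_add, mul_add, add_mul, add_mul_four, hX, hY]
      | tmul x y z =>
        induction Z using induction_three with
        | add X Y hX hY => simp only [map_add, mul_add, add_mul, mul_add_four, hX, hY]
        | tmul x' y' z' =>
          simp [K, tmulOne_tmul, oneTmul_apply, conv₄_tmul, qFun_tmul, pFun_tmul, inl_apply,
            inr_apply, q.S_mul, mul_assoc]
  have outer : ∀ Y, K (tmulOne q.PhiInv * q.comul₂ Y * oneTmul q.PhiInv) = q.middle Y :=
      fun Y => by
    induction Y using induction_three with
    | add X Y hX hY => simp only [map_add, mul_add_four, add_mul_four, hX, hY]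
    | tmul a b c => rw [comul₂_tmul, inner, qFun_phiInv, pFun_phiInv, middle_tmul]
  have one_eq : K 1 = inl q.alpha * inr q.beta := by
    simp [K, Algebra.TensorProduct.one_def, conv₄_tmul, q.S_one]
    rw [← Algebra.TensorProduct.one_def, one_mul, mul_one]
  rw [← outer, pentagon_phiInv, ← mul_one_four (q.comul₁ _ * _), mul_assoc_four,
    conv₄_comul₁_phiInv_mul (q.leftInv_alpha inl), mul_one_four, ← one_mul_four (q.comul₃ _),
    conv₄_mul_comul₃_phiInv (q.rightInv_beta inr)]
  exact one_eq

theorem sum_scopₗ_mul_aEl :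
    conv (LinearMap.mulRight k q.aEl ∘ₗ q.scopₗ)
      (conv q.comul.toLinearMap (LinearMap.mulLeft k q.pRE ∘ₗ inr.toLinearMap ∘ₗ q.S)) q.PhiInv =
      q.sswap q.qRE := by
  let K := conv₄ ((inr (k := k)).toLinearMap ∘ₗ LinearMap.mulRight k q.alpha ∘ₗ q.S)
    (inl.toLinearMap ∘ₗ q.S) (LinearMap.mulLeft k q.qLE ∘ₗ q.comul.toLinearMap)
    (LinearMap.mulLeft k q.pRE ∘ₗ inr.toLinearMap ∘ₗ q.S)
  have left : ∀ X Y, K (tmulOne X * q.comul₁ Y) =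
      conv (LinearMap.mulRight k (q.aFun X) ∘ₗ q.scopₗ)
        (conv q.comul.toLinearMap (LinearMap.mulLeft k q.pRE ∘ₗ inr.toLinearMap ∘ₗ q.S)) Y :=
      fun X Y => by
    induction Y using induction_three with
    | add Y Y' hY hY' => simp only [map_add, mul_add_four, hY, hY']
    | tmul a b c =>
      induction X using induction_three with
      | add X X' hX hX' =>
        simp only [map_add, add_mul_four, hX, hX']
        simp [mul_add, add_mul]
      | tmul x y z =>
        rw [comul₁_tmul]
        simp only [conv_tmul, LinearMap.comp_apply, LinearMap.mulRight_apply, scopₗ_apply,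
          AlgHom.toLinearMap_apply, LinearMap.mulLeft_apply]
        generalize q.comul a = t
        induction t using induction_two with
        | add s t hs ht => simp only [map_add, add_tmul, add_mul, mul_add_four, hs, ht]
        | tmul s t =>
          simp [K, tmulOne_tmul, conv₄_tmul, aFun_tmul, sswap_tmul, q.S_mul, mul_assoc,
            inr_mul_inl_assoc]
  have inner : ∀ a t c x y z r s t', K (a ⊗ₜ TensorProduct.assoc k H H H (t ⊗ₜ c) *
      oneTmul (x ⊗ₜ (y ⊗ₜ z)) * r ⊗ₜ (s ⊗ₜ t')) =
        inr (q.S r * q.S a * q.alpha) * (inl (q.S s * q.S x) * (q.comulQ t * (q.comul y *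
          (q.comulP t' * inr (q.S z * q.S c))))) := fun a t c x y z r s t' => by
    induction t using induction_two with
    | add s t hs ht =>
      simp only [map_add, add_tmul, tmul_add, mul_add, add_mul, add_mul_four, hs, ht]
    | tmul b b' =>
      induction t' using induction_two with
      | add s t hs ht => simp only [map_add, tmul_add, mul_add, add_mul, mul_add_four, hs, ht]
      | tmul d d' =>
        simp [K, oneTmul_apply, conv₄_tmul, comulQ_tmul, comulP_tmul, q.S_mul, mul_assoc]
  have middle_eq : ∀ a b c Z r s d, K (q.comul₂ (a ⊗ₜ (b ⊗ₜ c)) * oneTmul Z *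
      q.comul₃ (r ⊗ₜ (s ⊗ₜ d))) =
        inr (q.S r * q.S a * q.alpha * b) * (inl (q.S s) *
          (q.middle Z * (inl d * inr (q.S c)))) := fun a b c Z r s d => by
    induction Z using induction_three with
    | add X Y hX hY => simp only [map_add, mul_add, add_mul, mul_add_four, add_mul_four, hX, hY]
    | tmul x y z =>
      rw [comul₂_tmul, comul₃_tmul, inner, comulQ_comul, comulP_comul]
      simp [middle_tmul, mul_assoc, inr_mul_inl_assoc]
  have right : ∀ Y W, K (q.comul₂ Y * oneTmul q.PhiInv * q.comul₃ W) =
      q.rFun W * inr (conv q.S (conv (LinearMap.mulLeft k q.alpha)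
        (LinearMap.mulLeft k q.beta ∘ₗ q.S)) Y) := fun Y W => by
    induction Y using induction_three with
    | add Y Y' hY hY' => simp only [map_add, mul_add, add_mul_four, hY, hY']
    | tmul a b c =>
      induction W using induction_three with
      | add W W' hW hW' => simp only [map_add, add_mul, mul_add_four, hW, hW']
      | tmul r s d =>
        rw [middle_eq, middle_phiInv]
        simp [rFun_tmul, mul_assoc, inr_mul_inl_assoc]
  have nondeg : conv q.S (conv (LinearMap.mulLeft k q.alpha)
      (LinearMap.mulLeft k q.beta ∘ₗ q.S)) q.PhiInv = 1 := by
    rw [← q.nondeg_2]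
    simp [PhiInv, mul_assoc]
  have e : tmulOne q.Phi * q.comul₁ q.PhiInv =
      q.comul₂ q.PhiInv * oneTmul q.PhiInv * q.comul₃ q.Phi := by
    have e₁ := q.map_phiInv_mul_phi q.comul₃
    have e₂ := q.map_phi_mul_phiInv (tmulOne (k := k) (H := H))
    have e₃ := congrArg (fun x => tmulOne q.Phi * x * q.comul₃ q.Phi) q.pentagon_phiInv
    simp only [mul_assoc_four, e₁, mul_one_four] at e₃
    rw [← mul_assoc_four, e₂, one_mul_four, ← mul_assoc_four] at e₃
    exact e₃.symm
  have e₀ := congrArg K e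
  rw [left, right, nondeg, map_one, mul_one, rFun_phi, aFun_phi] at e₀
  exact e₀

theorem sum_comul_mul_bEl :
    conv q.comul.toLinearMap (conv (LinearMap.mulLeft k q.bEl ∘ₗ q.scopₗ)
      (LinearMap.mulLeft k (q.sswap q.qRE) ∘ₗ inl.toLinearMap)) q.Phi = q.pRE := by
  let K := conv₄ (LinearMap.mulRight k q.pRE ∘ₗ q.comul.toLinearMap) (inr.toLinearMap ∘ₗ q.S)
    (inl.toLinearMap ∘ₗ LinearMap.mulLeft k q.beta ∘ₗ q.S)
    (inl.toLinearMap ∘ₗ LinearMap.mulLeft k q.alpha)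
  have leftInv : q.LeftInv ((inl (k := k)).toLinearMap ∘ₗ LinearMap.mulLeft k q.beta ∘ₗ q.S)
      (inl.toLinearMap ∘ₗ LinearMap.mulLeft k q.alpha) :=
    leftInv_of (U := fun x => inl (q.beta * q.S x)) (V := inl) (by simp [q.S_mul, mul_assoc])
      (by simp [mul_assoc]) (q.conv_alpha inl) (by simp [mul_assoc])
  have inner : ∀ a t c X Z,
      K (oneTmul Z * a ⊗ₜ TensorProduct.assoc k H H H (t ⊗ₜ c) * tmulOne X) =
        q.comul a * (q.bFun X * q.sswap t * (q.rFun Z * inl c)) := fun a t c X Z => by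
    induction t using induction_two with
    | add s t hs ht =>
      simp only [map_add, add_tmul, tmul_add, mul_add, add_mul, mul_add_four, add_mul_four, hs, ht]
    | tmul s t =>
      induction X using induction_three with
      | add X Y hX hY => simp only [map_add, mul_add, add_mul, mul_add_four, hX, hY]
      | tmul x y z =>
        induction Z using induction_three with
        | add X Y hX hY => simp only [map_add, mul_add, add_mul, add_mul_four, hX, hY]
        | tmul x' y' z' =>
          simp [K, tmulOne_tmul, oneTmul_apply, conv₄_tmul, bFun_tmul, rFun_tmul, sswap_tmul,
            q.S_mul, mul_assoc, inr_mul_inl, inr_mul_inl_assoc]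
  have left : ∀ Y, K (oneTmul q.Phi * q.comul₂ Y * tmulOne q.Phi) =
      conv q.comul.toLinearMap (conv (LinearMap.mulLeft k q.bEl ∘ₗ q.scopₗ)
        (LinearMap.mulLeft k (q.sswap q.qRE) ∘ₗ inl.toLinearMap)) Y := fun Y => by
    induction Y using induction_three with
    | add X Y hX hY => simp only [map_add, mul_add_four, add_mul_four, hX, hY]
    | tmul a b c =>
      rw [comul₂_tmul, inner, bFun_phi, rFun_phi]
      rfl
  have right : ∀ Y, K (q.comul₁ Y) = q.pRE * inl
      (conv (LinearMap.mulRight k q.beta) (conv q.S (LinearMap.mulLeft k q.alpha)) Y) :=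
      fun Y => by
    induction Y using induction_three with
    | add X Y hX hY => simp only [map_add, mul_add, hX, hY]
    | tmul a b c =>
      have key : ∀ t, K (TensorProduct.assoc k H H (H ⊗[k] H) (t ⊗ₜ (b ⊗ₜ c))) =
          q.comulP t * inl (q.beta * q.S b * (q.alpha * c)) := fun t => by
        induction t using induction_two with
        | add s t hs ht => simp only [map_add, add_tmul, add_mul, hs, ht]
        | tmul s t => simp [K, conv₄_tmul, comulP_tmul, mul_assoc]
      rw [comul₁_tmul, key, comulP_comul]
      simp [mul_assoc]
  rw [← left, ← comul₃_mul_comul₁_phi, conv₄_comul₃_phi_mul leftInv]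
  exact (right _).trans (by rw [conv_phi, map_one, mul_one])

theorem sum_qL2_mul_VL : ∑ c ∈ Finset.range q.nq,
    (q.qL2 c ⊗ₜ[k] (1 : H)) * q.VL * q.comul (q.Sinv (q.qL1 c)) = q.qRE := by
  apply q.sswap_injective
  rw [← sum_scopₗ_mul_aEl, PhiInv, map_sum, map_sum]
  refine Finset.sum_congr rfl fun c _ => ?_
  rw [sswap_mul, sswap_mul, VL, sswap_sswapInv, ← scopₗ_apply, sswap_tmul, q.S_one, map_one,
    one_mul, ← mul_assoc, ← mul_assoc, scopₗ_mul_twist, q.S_Sinv, qL1, qL2, map_mul, map_mul,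
    ← mul_assoc, ← mul_assoc, ← scopₗ_mul_twist, mul_assoc (q.scopₗ _), twist_mul_comul_alpha]
  simp [mul_assoc]

theorem sum_comul_mul_UL : ∑ c ∈ Finset.range q.np,
    q.comul (q.S (q.pL1 c)) * q.UL * (q.pL2 c ⊗ₜ[k] (1 : H)) = q.pRE := by
  rw [← sum_comul_mul_bEl, Phi, map_sum]
  refine Finset.sum_congr rfl fun c _ => ?_
  rw [UL, ← mul_assoc, ← twistInv_mul_scopₗ, pL1, pL2, scopₗ_mul, ← mul_assoc,
    twistInv_mul_scopₗ, q.S_Sinv, map_mul, mul_assoc (q.comul _), comul_beta_mul_twistInv,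
    ← inl_apply]
  simp [mul_assoc]

end QuasiHopf

/-- `(q^L_2 ⊗ 1) · V^L · Δ(S̄(q^L_1)) = q^R` and
`Δ(S(p^L_1)) · U^L · (p^L_2 ⊗ 1) = p^R` in `H ⊗ H`. -/
theorem statement5 (k H : Type) [Field k] [Ring H] [Algebra k H] (q : QuasiHopf k H) :
    (∑ c ∈ Finset.range q.nq,
        (q.qL2 c ⊗ₜ[k] (1 : H)) * q.VL * q.comul (q.Sinv (q.qL1 c)) = q.qRE) ∧
    (∑ c ∈ Finset.range q.np,
        q.comul (q.S (q.pL1 c)) * q.UL * (q.pL2 c ⊗ₜ[k] (1 : H)) = q.pRE) := by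
  exact ⟨q.sum_qL2_mul_VL, q.sum_comul_mul_UL⟩
end
end

section
/- Let H be a quasi-Hopf algebra over a field k with bijective antipode S (inverse S̄) and μ : H → k an algebra map. Suppose λ ∈ H* satisfies q^R_1 h_(1) p^R_1 · ⟨λ, q^R_2 h_(2) p^R_2⟩ = μ(φ̄1)·⟨λ, S̄(q^L_1) h S(φ̄2 p^L_1)⟩ · q^L_2 φ̄3 p^L_2 for all h ∈ H, and Λ ∈ H satisfies hΛ = ε(h)Λ and Λh = μ(h)Λ for all h ∈ H. Then q^R_1 Λ_(1) p^R_1 · ⟨λ, q^R_2 Λ_(2) p^R_2⟩ = μ(β)·λ(Λ)·1. -/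
open scoped TensorProduct

noncomputable section

namespace QuasiHopf

variable {k H : Type} [Field k] [Ring H] [Algebra k H] (q : QuasiHopf k H)

/-- `x ⊗ y ⊗ z ↦ f(x) g(y) z` for characters `f` and `g`. -/
def evalLeftTwo (f g : H →ₐ[k] k) : H ⊗[k] (H ⊗[k] H) →ₐ[k] H :=
  (Algebra.TensorProduct.lid k H).toAlgHom.comp
    (Algebra.TensorProduct.map f
      ((Algebra.TensorProduct.lid k H).toAlgHom.comp
        (Algebra.TensorProduct.map g (AlgHom.id k H))))

@[simp]
theorem evalLeftTwo_tmul (f g : H →ₐ[k] k) (x y z : H) :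
    evalLeftTwo f g (x ⊗ₜ[k] (y ⊗ₜ[k] z)) = (f x * g y) • z := by
  simp [evalLeftTwo, mul_smul, smul_comm (g y)]

/-- A character composed with the antipode is again a character. -/
def charComp (mu : H →ₐ[k] k) : H →ₐ[k] k :=
  AlgHom.ofLinearMap (mu.toLinearMap.comp q.S) (by simp [q.S_one])
    (fun x y => by simp [q.S_mul, mul_comm])

@[simp]
theorem charComp_apply (mu : H →ₐ[k] k) (x : H) : q.charComp mu x = mu (q.S x) := rfl

theorem evalLeftTwo_phiInv_mul_phi (f g : H →ₐ[k] k) :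
    evalLeftTwo f g q.PhiInv * evalLeftTwo f g q.Phi = 1 := by
  rw [← map_mul, PhiInv, Phi, q.phiInv_phi, map_one]

theorem counit_S (h : H) : q.counit (q.S h) = q.counit h := by
  have hα := congrArg q.counit (q.antipode_alpha h)
  have hr := congrArg (fun x => q.counit (q.S x)) (q.counit_right h)
  simp only [map_sum, map_mul, map_smul, q.counit_alpha, smul_eq_mul, mul_one] at hα hr
  rw [← hr, ← hα]
  exact Finset.sum_congr rfl fun _ _ => mul_comm _ _

theorem counit_Sinv (h : H) : q.counit (q.Sinv h) = q.counit h := by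
  rw [← q.counit_S, q.S_Sinv]

theorem evalLeftTwo_counit_phi : evalLeftTwo q.counit q.counit q.Phi = 1 := by
  have h := congrArg (fun t => TensorProduct.lid k H
    (TensorProduct.map q.counit.toLinearMap LinearMap.id t)) q.counit_mid_phi
  simp only [map_sum, map_smul, TensorProduct.map_tmul, TensorProduct.lid_tmul,
    AlgHom.toLinearMap_apply, LinearMap.id_apply, map_one, one_smul] at h
  rw [Phi, map_sum, ← h]
  exact Finset.sum_congr rfl fun _ _ => by rw [evalLeftTwo_tmul, mul_comm, mul_smul]

theorem sum_counit_qL1_smul_qL2 :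
    ∑ c ∈ Finset.range q.nq, q.counit (q.qL1 c) • q.qL2 c = 1 := by
  have h := q.evalLeftTwo_phiInv_mul_phi q.counit q.counit
  rw [q.evalLeftTwo_counit_phi, mul_one, PhiInv, map_sum] at h
  simpa [qL1, qL2, q.counit_S, q.counit_alpha] using h

theorem sum_mu_S_pL1_smul_pL2 (mu : H →ₐ[k] k) :
    ∑ e ∈ Finset.range q.np, mu (q.S (q.pL1 e)) • q.pL2 e =
      mu q.beta • evalLeftTwo mu (q.charComp mu) q.Phi := by
  rw [Phi, map_sum, Finset.smul_sum]
  refine Finset.sum_congr rfl fun e _ => ?_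
  rw [evalLeftTwo_tmul, smul_smul, charComp_apply, pL1, pL2, q.S_mul, q.S_Sinv, map_mul, map_mul]
  congr 1
  ring

end QuasiHopf

/-- If `λ ∈ H*` satisfies equation (3.2) (Lemma 4.5) and `Λ` is a
left integral with `Λ h = μ(h) Λ`, then
`q^R_1 Λ₍₁₎ p^R_1 ⟨λ, q^R_2 Λ₍₂₎ p^R_2⟩ = μ(β) λ(Λ) 1`. -/
theorem statement7 (k H : Type) [Field k] [Ring H] [Algebra k H] (q : QuasiHopf k H)
    (mu : H →ₐ[k] k) (lam : H →ₗ[k] k)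
    (hyp : ∀ h : H, hitR lam (q.qRE * q.comul h * q.pRE) =
      ∑ b ∈ Finset.range q.nq, ∑ c ∈ Finset.range q.nq, ∑ e ∈ Finset.range q.np,
        (mu (q.Q1 b) * lam (q.Sinv (q.qL1 c) * h * q.S (q.Q2 b * q.pL1 e))) •
          (q.qL2 c * q.Q3 b * q.pL2 e))
    (Lam : H) (hint : ∀ h : H, h * Lam = q.counit h • Lam)
    (hmod : ∀ h : H, Lam * h = mu h • Lam) :
    hitR lam (q.qRE * q.comul Lam * q.pRE) = (mu q.beta * lam Lam) • (1 : H) := by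
  have hterm : ∀ b c e : ℕ,
      (mu (q.Q1 b) * lam (q.Sinv (q.qL1 c) * Lam * q.S (q.Q2 b * q.pL1 e))) •
        (q.qL2 c * q.Q3 b * q.pL2 e) =
      lam Lam • ((q.counit (q.qL1 c) • q.qL2 c) *
        (QuasiHopf.evalLeftTwo mu (q.charComp mu) (q.Q1 b ⊗ₜ[k] (q.Q2 b ⊗ₜ[k] q.Q3 b))) *
        (mu (q.S (q.pL1 e)) • q.pL2 e)) := by
    intro b c e
    rw [hint, smul_mul_assoc, hmod, q.counit_Sinv, q.S_mul, map_mul,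
      QuasiHopf.evalLeftTwo_tmul, QuasiHopf.charComp_apply]
    simp only [map_smul, smul_mul_assoc, mul_smul_comm, smul_smul, smul_eq_mul]
    congr 1
    ring
  rw [hyp]
  simp only [hterm, ← Finset.smul_sum, ← Finset.mul_sum]
  simp only [← Finset.sum_mul, q.sum_counit_qL1_smul_qL2, one_mul, ← map_sum,
    q.sum_mu_S_pL1_smul_pL2]
  rw [← QuasiHopf.PhiInv, mul_smul_comm, q.evalLeftTwo_phiInv_mul_phi, smul_smul, mul_comm]
end
end
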